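/- arXiv:2206.03832 — 10 statements merged into one kernel-verified Lean document; each statement's English description precedes it below -/
import Mathlib

section
/- Let d ≥ 1 and 1 ≤ l ≤ d, let n_1,…,n_d be positive integers, and let A be a type with a distinguished element a_0. Suppose given 'left' partial functions f_j : Fin n_j → A → Option A for 1 ≤ j ≤ l−1, 'right' partial functions g_j : Fin n_j → A → Option A for l+1 ≤ j ≤ d, and a 'middle' function h : Fin n_l → A → A → ℂ. Define the left images D_0 = {a_0}, D_j = { y : ∃ i ∈ Fin n_j, ∃ x ∈ D_{j−1}, f_j i x = some y } for 1 ≤ j ≤ l−1, and the right images E_d = {a_0}, E_{j} = { y : ∃ i ∈ Fin n_{j+1}, ∃ x ∈ E_{j+1}, g_{j+1} i x = some y } for l ≤ j ≤ d−1 (these sets are finite). Define the tensor K : Fin n_1 × ⋯ × Fin n_d → ℂ by: K(i_1,…,i_d) = h i_l a b if the forward recursion a_1 = f_1 i_1 a_0, a_2 = f_2 i_2 a_1, …, a_{l−1} = f_{l−1} i_{l−1} a_{l−2} succeeds (no step returns none) with final value a = a_{l−1}, and the backward recursion c_d = g_d i_d a_0, c_{d−1} = g_{d−1} i_{d−1}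 c_d, …, c_{l+1} = g_{l+1} i_{l+1} c_{l+2} succeeds with final value b = c_{l+1}; and K(i_1,…,i_d) = 0 if any step of either recursion returns none. Then K admits a TT-decomposition with ranks r_j ≤ |D_j| for 0 ≤ j ≤ l−1 and r_j ≤ |E_j| for l ≤ j ≤ d. -/
/-- A TT-decomposition of the tensor `T` (with mode sizes `n`) with ranks `r`. -/
def IsTTDecomp {d : ℕ} (n : Fin d → ℕ) (r : Fin (d + 1) → ℕ)
    (T : (∀ j : Fin d, Fin (n j)) → ℂ) : Prop :=
  r 0 = 1 ∧ r (Fin.last d) = 1 ∧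
  ∃ G : ∀ j : Fin d, Fin (n j) → Matrix (Fin (r j.castSucc)) (Fin (r j.succ)) ℂ,
    ∀ i, T i = ∑ α : ∀ j : Fin (d + 1), Fin (r j),
      ∏ j : Fin d, G j (i j) (α j.castSucc) (α j.succ)

/-- The forward (left-to-right) recursion `a_0 = a0`, `a_{k+1} = f_{k+1} i_{k+1} a_k`,
propagating `none` on failure. -/
def fwdRec {A : Type*} {d : ℕ} {n : Fin d → ℕ}
    (f : ∀ j : Fin d, Fin (n j) → A → Option A) (a0 : A)
    (i : ∀ j : Fin d, Fin (n j)) : ℕ → Option A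
  | 0 => some a0
  | k + 1 =>
    if hk : k < d then (fwdRec f a0 i k).bind (f ⟨k, hk⟩ (i ⟨k, hk⟩)) else none

/-- The backward (right-to-left) recursion: `bwdRec g a0 i m` is the result of applying
the `m` rightmost functions, starting with `c_d = g_d i_d a0` and moving leftwards. -/
def bwdRec {A : Type*} {d : ℕ} {n : Fin d → ℕ}
    (g : ∀ j : Fin d, Fin (n j) → A → Option A) (a0 : A)
    (i : ∀ j : Fin d, Fin (n j)) : ℕ → Option A
  | 0 => some a0
  | m + 1 =>
    if hm : m < d then
      (bwdRec g a0 i m).bind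
        (g ⟨d - 1 - m, by omega⟩ (i ⟨d - 1 - m, by omega⟩))
    else none

/-- The left images: `fwdIm f a0 j = D_j`, the set of attainable values of the
forward recursion after `j` steps. -/
def fwdIm {A : Type*} {d : ℕ} {n : Fin d → ℕ}
    (f : ∀ j : Fin d, Fin (n j) → A → Option A) (a0 : A) : ℕ → Set A
  | 0 => {a0}
  | k + 1 =>
    if hk : k < d then
      {y | ∃ (ik : Fin (n ⟨k, hk⟩)) (x : A), x ∈ fwdIm f a0 k ∧ f ⟨k, hk⟩ ik x = some y}
    else ∅

/-- The right images: `bwdIm g a0 m` is the set of attainable values of the backward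
recursion after `m` steps from the right end (so the paper's `E_j` is `bwdIm g a0 (d−j)`). -/
def bwdIm {A : Type*} {d : ℕ} {n : Fin d → ℕ}
    (g : ∀ j : Fin d, Fin (n j) → A → Option A) (a0 : A) : ℕ → Set A
  | 0 => {a0}
  | m + 1 =>
    if hm : m < d then
      {y | ∃ (ik : Fin (n ⟨d - 1 - m, by omega⟩)) (x : A),
        x ∈ bwdIm g a0 m ∧ g ⟨d - 1 - m, by omega⟩ ik x = some y}
    else ∅

lemma isTTDecomp_ncard {A : Type*} {d : ℕ} {n : Fin d → ℕ}
    {T : (∀ j : Fin d, Fin (n j)) → ℂ} (S : Fin (d + 1) → Set A) [∀ j, Fintype (S j)]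
    (h_zero : (S 0).ncard = 1) (h_last : (S (Fin.last d)).ncard = 1)
    (c : ∀ j : Fin d, Fin (n j) → A → A → ℂ)
    (hT : ∀ i, T i = ∑ s : ∀ j, S j, ∏ j : Fin d, c j (i j) (s j.castSucc) (s j.succ)) :
    IsTTDecomp n (fun j => (S j).ncard) T := by
  let e : ∀ j, Fin (S j).ncard ≃ S j := fun j =>
    (Finite.equivFinOfCardEq (Nat.card_coe_set_eq (S j))).symm
  refine ⟨h_zero, h_last, fun j k => Matrix.of fun α β => c j k (e _ α) (e _ β), fun i => ?_⟩
  rw [hT i, ← Equiv.sum_comp (Equiv.piCongrRight e)]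
  rfl

lemma finite_setOf_exists_eq_some {ι A B : Type*} [Finite ι] (f : ι → A → Option B)
    {S : Set A} (hS : S.Finite) : {y | ∃ i x, x ∈ S ∧ f i x = some y}.Finite := by
  have hfin : ((fun p : ι × A => f p.1 p.2) '' (Set.univ ×ˢ S)).Finite :=
    (Set.finite_univ.prod hS).image _
  refine (hfin.preimage (Option.some_injective B).injOn).subset ?_
  rintro y ⟨i, x, hx, hy⟩
  exact ⟨(i, x), ⟨trivial, hx⟩, hy⟩

section Recursions

variable {A : Type*} {d : ℕ} {n : Fin d → ℕ} {f g : ∀ j : Fin d, Fin (n j) → A → Option A}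
  {a0 : A} {i : ∀ j : Fin d, Fin (n j)}

lemma finite_fwdIm (f : ∀ j : Fin d, Fin (n j) → A → Option A) (a0 : A) (k : ℕ) :
    (fwdIm f a0 k).Finite := by
  induction k with
  | zero => exact Set.finite_singleton a0
  | succ k ih =>
    rw [fwdIm]
    split_ifs
    exacts [finite_setOf_exists_eq_some _ ih, Set.finite_empty]

lemma finite_bwdIm (g : ∀ j : Fin d, Fin (n j) → A → Option A) (a0 : A) (m : ℕ) :
    (bwdIm g a0 m).Finite := by
  induction m with
  | zero => exact Set.finite_singleton a0
  | succ m ih =>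
    rw [bwdIm]
    split_ifs
    exacts [finite_setOf_exists_eq_some _ ih, Set.finite_empty]

lemma fwdRec_succ {k : ℕ} (hk : k < d) :
    fwdRec f a0 i (k + 1) = (fwdRec f a0 i k).bind (f ⟨k, hk⟩ (i ⟨k, hk⟩)) := by
  rw [fwdRec, dif_pos hk]

lemma bwdRec_sub {k : ℕ} (hk : k < d) :
    bwdRec g a0 i (d - k) = (bwdRec g a0 i (d - (k + 1))).bind (g ⟨k, hk⟩ (i ⟨k, hk⟩)) := by
  obtain ⟨m, hm, rfl⟩ : ∃ m, m < d ∧ k = d - 1 - m := ⟨d - 1 - k, by omega, by omega⟩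
  rw [show d - (d - 1 - m) = m + 1 by omega, show d - (d - 1 - m + 1) = m by omega, bwdRec,
    dif_pos hm]

lemma mem_fwdIm_of_fwdRec {k : ℕ} {y : A} (hy : fwdRec f a0 i k = some y) :
    y ∈ fwdIm f a0 k := by
  induction k generalizing y with
  | zero => exact (Option.some.inj hy).symm
  | succ k ih =>
    rw [fwdRec] at hy
    split_ifs at hy with hk
    obtain ⟨x, hx, hxy⟩ := Option.bind_eq_some_iff.1 hy
    rw [fwdIm, dif_pos hk]
    exact ⟨_, x, ih hx, hxy⟩

lemma mem_bwdIm_of_bwdRec {m : ℕ} {y : A} (hy : bwdRec g a0 i m = some y) :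
    y ∈ bwdIm g a0 m := by
  induction m generalizing y with
  | zero => exact (Option.some.inj hy).symm
  | succ m ih =>
    rw [bwdRec] at hy
    split_ifs at hy with hm
    obtain ⟨x, hx, hxy⟩ := Option.bind_eq_some_iff.1 hy
    rw [bwdIm, dif_pos hm]
    exact ⟨_, x, ih hx, hxy⟩

lemma exists_fwdRec_eq_some_of_le {k m : ℕ} (hkm : k ≤ m)
    (hm : ∃ y, fwdRec f a0 i m = some y) : ∃ y, fwdRec f a0 i k = some y := by
  induction m, hkm using Nat.le_induction with
  | base => exact hm
  | succ m _ ih =>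
    obtain ⟨y, hy⟩ := hm
    rw [fwdRec] at hy
    split_ifs at hy
    obtain ⟨x, hx, -⟩ := Option.bind_eq_some_iff.1 hy
    exact ih ⟨x, hx⟩

lemma exists_bwdRec_eq_some_of_le {k m : ℕ} (hkm : k ≤ m)
    (hm : ∃ y, bwdRec g a0 i m = some y) : ∃ y, bwdRec g a0 i k = some y := by
  induction m, hkm using Nat.le_induction with
  | base => exact hm
  | succ m _ ih =>
    obtain ⟨y, hy⟩ := hm
    rw [bwdRec] at hy
    split_ifs at hy
    obtain ⟨x, hx, -⟩ := Option.bind_eq_some_iff.1 hy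
    exact ih ⟨x, hx⟩

/-- A path from `a0` following the functions `f` at the first `p` positions is the trajectory
of the forward recursion. -/
lemma fwdRec_eq_some_of_path {p : ℕ} (s : Fin (d + 1) → A) (h_zero : s 0 = a0)
    (hs : ∀ j : Fin d, (j : ℕ) < p → f j (i j) (s j.castSucc) = some (s j.succ))
    (j : Fin (d + 1)) (hj : (j : ℕ) ≤ p) : fwdRec f a0 i j = some (s j) := by
  induction j using Fin.induction with
  | zero => rw [h_zero]; rfl
  | succ j ih =>
    have hjp : (j : ℕ) < p := hj
    rw [Fin.val_succ, fwdRec_succ j.isLt]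
    exact Option.bind_eq_some_iff.2 ⟨_, ih hjp.le, hs j hjp⟩

/-- A path to `a0` following the functions `g` backwards at the positions from `p` on is the
trajectory of the backward recursion. -/
lemma bwdRec_eq_some_of_path {p : ℕ} (s : Fin (d + 1) → A) (h_last : s (Fin.last d) = a0)
    (hs : ∀ j : Fin d, p ≤ (j : ℕ) → g j (i j) (s j.succ) = some (s j.castSucc))
    (j : Fin (d + 1)) (hj : p ≤ (j : ℕ)) : bwdRec g a0 i (d - j) = some (s j) := by
  induction j using Fin.reverseInduction with
  | last => rw [h_last, Fin.val_last, Nat.sub_self]; rfl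
  | cast j ih =>
    have hjp : p ≤ (j : ℕ) := hj
    rw [Fin.val_castSucc, bwdRec_sub j.isLt]
    exact Option.bind_eq_some_iff.2 ⟨_, ih (hjp.trans (Nat.le_succ _)), hs j hjp⟩

end Recursions

/-- The sets of states of the decomposition: left images up to position `l - 1`, right images
from position `l` on. -/
def ttStates {A : Type*} {d : ℕ} {n : Fin d → ℕ} (f g : ∀ j : Fin d, Fin (n j) → A → Option A)
    (a0 : A) (l : ℕ) (j : Fin (d + 1)) : Set A :=
  if (j : ℕ) < l then fwdIm f a0 j else bwdIm g a0 (d - j)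

/-- The trajectory of the two recursions. -/
def ttTraj {A : Type*} {d : ℕ} {n : Fin d → ℕ} (f g : ∀ j : Fin d, Fin (n j) → A → Option A)
    (a0 : A) (l : ℕ) (i : ∀ j : Fin d, Fin (n j)) (j : Fin (d + 1)) : Option A :=
  if (j : ℕ) < l then fwdRec f a0 i j else bwdRec g a0 i (d - j)

open Classical in
/-- The entries of the cores: transition indicators of `f` on the left and of `g` on the right,
and the middle function `h` at position `p`. -/
noncomputable def ttCore {A : Type*} {d : ℕ} {n : Fin d → ℕ}
    (f g : ∀ j : Fin d, Fin (n j) → A → Option A) (p : Fin d) (h : Fin (n p) → A → A → ℂ)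
    (j : Fin d) (k : Fin (n j)) (x y : A) : ℂ :=
  if j < p then if f j k x = some y then 1 else 0
  else if hj : j = p then h (Fin.cast (congrArg n hj) k) x y
  else if g j k y = some x then 1 else 0

section Core

variable {A : Type*} {d : ℕ} {n : Fin d → ℕ} {f g : ∀ j : Fin d, Fin (n j) → A → Option A}
  {a0 : A} {i : ∀ j : Fin d, Fin (n j)} {p : Fin d} {h : Fin (n p) → A → A → ℂ}

lemma finite_ttStates (l : ℕ) (j : Fin (d + 1)) : (ttStates f g a0 l j).Finite := by
  rw [ttStates]
  split_ifs
  exacts [finite_fwdIm _ _ _, finite_bwdIm _ _ _]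

lemma mem_ttStates_of_ttTraj {l : ℕ} {j : Fin (d + 1)} {y : A}
    (hy : ttTraj f g a0 l i j = some y) : y ∈ ttStates f g a0 l j := by
  rw [ttTraj] at hy
  rw [ttStates]
  split_ifs at hy ⊢
  exacts [mem_fwdIm_of_fwdRec hy, mem_bwdIm_of_bwdRec hy]

lemma ttStates_zero : ttStates f g a0 (p + 1) 0 = {a0} := by
  simp [ttStates, fwdIm]

lemma ttStates_last : ttStates f g a0 (p + 1) (Fin.last d) = {a0} := by
  rw [ttStates, if_neg (by have := p.isLt; simp only [Fin.val_last]; omega), Fin.val_last,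
    Nat.sub_self, bwdIm]

/-- A path on which no core entry vanishes is the trajectory of the recursions. -/
lemma ttTraj_eq_some_of_ttCore_ne_zero (s : Fin (d + 1) → A) (h_zero : s 0 = a0)
    (h_last : s (Fin.last d) = a0)
    (hs : ∀ j : Fin d, ttCore f g p h j (i j) (s j.castSucc) (s j.succ) ≠ 0)
    (j : Fin (d + 1)) : ttTraj f g a0 (p + 1) i j = some (s j) := by
  rw [ttTraj]
  split_ifs with hj
  · refine fwdRec_eq_some_of_path s h_zero (fun k hk => ?_) j (Nat.lt_succ_iff.1 hj)
    by_contra hne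
    exact hs k (by rw [ttCore, if_pos (Fin.lt_def.2 hk), if_neg hne])
  · refine bwdRec_eq_some_of_path s h_last (fun k hk => ?_) j (not_lt.1 hj)
    by_contra hne
    have hpk : p < k := Fin.lt_def.2 hk
    exact hs k (by rw [ttCore, if_neg hpk.not_gt, dif_neg hpk.ne', if_neg hne])

/-- Along the trajectory of the recursions only the middle core contributes. -/
lemma prod_ttCore_of_ttTraj (s : Fin (d + 1) → A)
    (hs : ∀ j, ttTraj f g a0 (p + 1) i j = some (s j)) :
    ∏ j : Fin d, ttCore f g p h j (i j) (s j.castSucc) (s j.succ) =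
      h (i p) (s p.castSucc) (s p.succ) := by
  rw [Finset.prod_eq_single p]
  · rw [ttCore, if_neg (lt_irrefl p), dif_pos rfl, Fin.cast_refl, id]
  · intro j _ hjp
    have h_left := hs j.castSucc
    have h_right := hs j.succ
    rw [ttTraj, Fin.val_castSucc] at h_left
    rw [ttTraj, Fin.val_succ] at h_right
    rcases lt_or_gt_of_ne hjp with hlt | hgt
    · have hlt' : (j : ℕ) < p := hlt
      rw [if_pos (by omega)] at h_left
      rw [if_pos (by omega), fwdRec_succ j.isLt, h_left] at h_right
      rw [ttCore, if_pos hlt]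
      exact if_pos h_right
    · have hgt' : (p : ℕ) < j := hgt
      rw [if_neg (by omega)] at h_right
      rw [if_neg (by omega), bwdRec_sub j.isLt, h_right] at h_left
      rw [ttCore, if_neg hgt.not_gt, dif_neg hjp]
      exact if_pos h_left
  · exact fun hp => absurd (Finset.mem_univ p) hp

end Core

/-- a tensor computed by a forward recursion (positions `1,…,l−1`), a
backward recursion (positions `d,…,l+1`) and a middle function `h` at position `l`
(yielding `0` as soon as one step fails) admits a TT-decomposition with ranks bounded
by the cardinalities of the images `D_j` (for `j ≤ l−1`) and `E_j` (for `j ≥ l`). -/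
theorem stmt0 {A : Type*} (a0 : A) (d l : ℕ) (hd : 1 ≤ d) (hl1 : 1 ≤ l) (hld : l ≤ d)
    (hm : l - 1 < d) (n : Fin d → ℕ) (hn : ∀ j, 0 < n j)
    (f g : ∀ j : Fin d, Fin (n j) → A → Option A)
    (h : Fin (n ⟨l - 1, hm⟩) → A → A → ℂ)
    (K : (∀ j : Fin d, Fin (n j)) → ℂ)
    (hK1 : ∀ i a b, fwdRec f a0 i (l - 1) = some a → bwdRec g a0 i (d - l) = some b →
      K i = h (i ⟨l - 1, hm⟩) a b)
    (hK2 : ∀ i, fwdRec f a0 i (l - 1) = none ∨ bwdRec g a0 i (d - l) = none → K i = 0) :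
    ∃ r : Fin (d + 1) → ℕ, IsTTDecomp n r K ∧
      (∀ j : Fin (d + 1), (j : ℕ) ≤ l - 1 → r j ≤ (fwdIm f a0 (j : ℕ)).ncard) ∧
      (∀ j : Fin (d + 1), l ≤ (j : ℕ) → r j ≤ (bwdIm g a0 (d - (j : ℕ))).ncard) := by
  obtain ⟨p, rfl⟩ : ∃ p, l = p + 1 := ⟨l - 1, by omega⟩
  let q : Fin d := ⟨p, hm⟩
  have hfin : ∀ j, Fintype (ttStates f g a0 (q + 1) j) := fun j =>
    (finite_ttStates (q + 1) j).fintype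
  refine ⟨fun j => (ttStates f g a0 (q + 1) j).ncard, isTTDecomp_ncard _ ?_ ?_
    (ttCore f g q h) fun i => ?_, fun j hj => ?_, fun j hj => ?_⟩
  · rw [ttStates_zero, Set.ncard_singleton]
  · rw [ttStates_last, Set.ncard_singleton]
  · have hpath : ∀ s : ∀ j, ttStates f g a0 (q + 1) j,
        ∏ j : Fin d, ttCore f g q h j (i j) (s j.castSucc) (s j.succ) ≠ 0 →
          ∀ j, ttTraj f g a0 (q + 1) i j = some (s j : A) := by
      intro s hs
      refine ttTraj_eq_some_of_ttCore_ne_zero (fun j => (s j : A)) ?_ ?_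
        fun j => Finset.prod_ne_zero_iff.1 hs j (Finset.mem_univ j)
      · exact ttStates_zero.subset (s 0).2
      · exact ttStates_last.subset (s (Fin.last d)).2
    have h_left : ttTraj f g a0 (q + 1) i q.castSucc = fwdRec f a0 i (p + 1 - 1) :=
      if_pos (Nat.lt_succ_self p)
    have h_right : ttTraj f g a0 (q + 1) i q.succ = bwdRec g a0 i (d - (p + 1)) :=
      if_neg (lt_irrefl (p + 1))
    by_cases hsucc : ∃ s : ∀ j, ttStates f g a0 (q + 1) j,
        ∀ j, ttTraj f g a0 (q + 1) i j = some (s j : A)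
    · obtain ⟨s, hs⟩ := hsucc
      rw [Finset.sum_eq_single s]
      · rw [prod_ttCore_of_ttTraj (fun j => (s j : A)) hs]
        exact hK1 i _ _ (h_left ▸ hs q.castSucc) (h_right ▸ hs q.succ)
      · intro t _ hts
        by_contra hne
        exact hts (funext fun j => Subtype.ext
          (Option.some.inj ((hpath t hne j).symm.trans (hs j))))
      · exact fun hs' => absurd (Finset.mem_univ s) hs'
    · rw [Finset.sum_eq_zero fun s _ => by_contra fun hne => hsucc ⟨s, hpath s hne⟩]
      apply hK2
      by_contra! hsome
      obtain ⟨hsome_left, hsome_right⟩ := hsome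
      have htraj : ∀ j, ∃ y, ttTraj f g a0 (q + 1) i j = some y := by
        intro j
        rw [ttTraj]
        split_ifs with hj
        · exact exists_fwdRec_eq_some_of_le (Nat.lt_succ_iff.1 hj)
            (Option.ne_none_iff_exists'.1 hsome_left)
        · exact exists_bwdRec_eq_some_of_le (Nat.sub_le_sub_left (not_lt.1 hj) d)
            (Option.ne_none_iff_exists'.1 hsome_right)
      choose y hy using htraj
      exact hsucc ⟨fun j => ⟨y j, mem_ttStates_of_ttTraj (hy j)⟩, hy⟩
  · exact (congrArg Set.ncard (if_pos (Nat.lt_succ_iff.2 hj))).le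
  · exact (congrArg Set.ncard (if_neg (not_lt.2 hj))).le
end

section
/- Let K ≥ 1, let r_0 = 1 and r_1,…,r_K be positive integers, and for each k ∈ {1,…,K} and each i ∈ Fin n_k let Q_k(i) ∈ ℝ^{r_{k−1} × r_k} be a matrix each of whose rows is either the zero row vector or a standard basis row vector (a single entry 1, all others 0). Define the matrix Z with rows indexed by tuples (i_1,…,i_K) ∈ Fin n_1 × ⋯ × Fin n_K and columns indexed by Fin r_K via Z((i_1,…,i_K), l) = (Q_1(i_1) · Q_2(i_2) ⋯ Q_K(i_K))(1, l). Then ZᵀZ is a diagonal matrix, and every diagonal entry of ZᵀZ is a nonnegative integer. -/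
/-- Ordered partial products `Q_1(i_1) ⋯ Q_k(i_k)` of a chain of real matrices with
compatible (varying) dimensions; `prefixProdR r M k` is the product of the first `k`
matrices, a matrix of size `r 0 × r k`. -/
def prefixProdR {d : ℕ} (r : Fin (d + 1) → ℕ)
    (M : ∀ j : Fin d, Matrix (Fin (r j.castSucc)) (Fin (r j.succ)) ℝ) :
    ∀ k : Fin (d + 1), Matrix (Fin (r 0)) (Fin (r k)) ℝ :=
  Fin.induction (motive := fun k => Matrix (Fin (r 0)) (Fin (r k)) ℝ) 1
    fun j P => P * M j

/-- A vector that is zero or a standard basis vector. -/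
def IsZeroOrBasis {ι : Type*} (v : ι → ℝ) : Prop :=
  (∀ y, v y = 0) ∨ ∃ y0, v y0 = 1 ∧ ∀ y, y ≠ y0 → v y = 0

theorem IsZeroOrBasis.mul_row {l m n : Type*} [Fintype m] {A : Matrix l m ℝ}
    {B : Matrix m n ℝ} {x : l} (hA : IsZeroOrBasis (A x)) (hB : ∀ y, IsZeroOrBasis (B y)) :
    IsZeroOrBasis ((A * B) x) := by
  rcases hA with h | ⟨y0, h1, h0⟩
  · exact Or.inl fun y => by simp [Matrix.mul_apply, h]
  · have hrow : (A * B) x = B y0 := by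
      ext z
      rw [Matrix.mul_apply, Finset.sum_eq_single y0 (fun y _ hy => by rw [h0 y hy, zero_mul])
        (by simp), h1, one_mul]
    rw [hrow]
    exact hB y0

theorem IsZeroOrBasis.mul_eq_zero {ι : Type*} {v : ι → ℝ} (hv : IsZeroOrBasis v) {l m : ι}
    (hlm : l ≠ m) : v l * v m = 0 := by
  rcases hv with h | ⟨y0, -, h0⟩
  · rw [h l, zero_mul]
  · by_cases hl : l = y0
    · rw [h0 m (fun hm => hlm (hl.trans hm.symm)), mul_zero]
    · rw [h0 l hl, zero_mul]

theorem IsZeroOrBasis.exists_natCast_eq {ι : Type*} {v : ι → ℝ} (hv : IsZeroOrBasis v)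
    (l : ι) : ∃ c : ℕ, v l = c := by
  rcases hv with h | ⟨y0, h1, h0⟩
  · exact ⟨0, by simp [h l]⟩
  · by_cases hl : l = y0
    · exact ⟨1, by simp [hl, h1]⟩
    · exact ⟨0, by simp [h0 l hl]⟩

theorem isZeroOrBasis_prefixProdR {d : ℕ} (r : Fin (d + 1) → ℕ)
    (M : ∀ j : Fin d, Matrix (Fin (r j.castSucc)) (Fin (r j.succ)) ℝ)
    (hM : ∀ j x, IsZeroOrBasis (M j x)) (k : Fin (d + 1)) (x : Fin (r 0)) :
    IsZeroOrBasis (prefixProdR r M k x) := by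
  induction k using Fin.induction with
  | zero => exact Or.inr ⟨x, Matrix.one_apply_eq x, fun y hy => Matrix.one_apply_ne' hy⟩
  | succ j ih =>
    have hsucc : prefixProdR r M j.succ = prefixProdR r M j.castSucc * M j := rfl
    rw [hsucc]
    exact ih.mul_row (hM j)

/-- if each row of each `Q_k(i)` is zero or a standard basis row vector,
then for `Z((i_1,…,i_K), l) = (Q_1(i_1)⋯Q_K(i_K))(1, l)`, the matrix `ZᵀZ` is diagonal
with nonnegative integer diagonal entries. -/
theorem stmt2 (K : ℕ) (hK : 1 ≤ K) (r : Fin (K + 1) → ℕ) (hr0 : r 0 = 1)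
    (hrpos : ∀ k, 0 < r k) (n : Fin K → ℕ)
    (Q : ∀ k : Fin K, Fin (n k) → Matrix (Fin (r k.castSucc)) (Fin (r k.succ)) ℝ)
    (hQ : ∀ (k : Fin K) (i : Fin (n k)) (x : Fin (r k.castSucc)),
      (∀ y, Q k i x y = 0) ∨
      (∃ y0, Q k i x y0 = 1 ∧ ∀ y, y ≠ y0 → Q k i x y = 0))
    (Z : Matrix (∀ k : Fin K, Fin (n k)) (Fin (r (Fin.last K))) ℝ)
    (hZ : ∀ i l, Z i l =
      prefixProdR r (fun k => Q k (i k)) (Fin.last K) ⟨0, by omega⟩ l) :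
    (∀ l m, l ≠ m → (Z.transpose * Z) l m = 0) ∧
    (∀ l, ∃ c : ℕ, (Z.transpose * Z) l l = c) := by
  have hrow : ∀ i, IsZeroOrBasis (Z i) := fun i => by
    rw [funext (hZ i)]
    exact isZeroOrBasis_prefixProdR r _ (fun j x => hQ j (i j) x) _ _
  refine ⟨fun l m hlm => ?_, fun l => ?_⟩
  · simp only [Matrix.mul_apply, Matrix.transpose_apply]
    exact Finset.sum_eq_zero fun i _ => (hrow i).mul_eq_zero hlm
  · choose c hc using fun i => (hrow i).exists_natCast_eq l
    exact ⟨∑ i, c i * c i, by simp [Matrix.mul_apply, hc]⟩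
end

section
/- Let d ≥ 2, let r_0 = 1 and r_1,…,r_{d−1} be positive integers with r_d = 1, and let T : Fin n_1 × ⋯ × Fin n_d → ℂ have a TT-decomposition with cores G_1,…,G_d of these ranks. Fix k ∈ {1,…,d−1}. Suppose: (i) for every j ≤ k and every i ∈ Fin n_j, each row of G_j(i) is either the zero row vector or a standard basis row vector; (ii) every column of the matrix Z_k, defined by Z_k((i_1,…,i_k), α) = (G_1(i_1)⋯G_k(i_k))(1, α) with rows indexed by tuples (i_1,…,i_k) and columns by Fin r_k, is nonzero; and (iii) the matrix Y_k, defined by Y_k(α, (i_{k+1},…,i_d)) = (G_{k+1}(i_{k+1})⋯G_d(i_d))(α, 1) with rows indexed by Fin r_k and columns by tuples (i_{k+1},…,i_d), has rank r_k. Then the k-th unfolding matrix of T, with rows indexed by tuples (i_1,…,i_k), columns indexed by tuples (i_{k+1},…,i_d), and entries T(i_1,…,i_d), has rank exactly r_k; in particular, every TT-decomposition of T has its k-th rank at least r_k. -/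
/-- Ordered partial products of a chain of complex matrices with compatible dimensions:
`prefixProdC r M k = M_1 ⋯ M_k`, a matrix of size `r 0 × r k`. -/
noncomputable def prefixProdC {d : ℕ} (r : Fin (d + 1) → ℕ)
    (M : ∀ j : Fin d, Matrix (Fin (r j.castSucc)) (Fin (r j.succ)) ℂ) :
    ∀ k : Fin (d + 1), Matrix (Fin (r 0)) (Fin (r k)) ℂ :=
  Fin.induction (motive := fun k => Matrix (Fin (r 0)) (Fin (r k)) ℂ) 1
    fun j P => P * M j

/-- Ordered partial products from the right: `suffixProdC r M k = M_{k+1} ⋯ M_d`,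
a matrix of size `r k × r d`. -/
noncomputable def suffixProdC {d : ℕ} (r : Fin (d + 1) → ℕ)
    (M : ∀ j : Fin d, Matrix (Fin (r j.castSucc)) (Fin (r j.succ)) ℂ) :
    ∀ k : Fin (d + 1), Matrix (Fin (r k)) (Fin (r (Fin.last d))) ℂ :=
  Fin.reverseInduction (motive := fun k => Matrix (Fin (r k)) (Fin (r (Fin.last d))) ℂ) 1
    fun j P => M j * P

/-- Left multiplication by a matrix having every standard basis vector among its rows preserves
the rank. -/
theorem Matrix.rank_mul_eq_right_of_rows_single {l m n K : Type*} [Fintype m]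
    [DecidableEq m] [Fintype n] [Field K] (Z : Matrix l m K) (Y : Matrix m n K)
    (f : m → l) (hf : ∀ a, Z (f a) = Pi.single a 1) : (Z * Y).rank = Y.rank := by
  have hY : (Z * Y).submatrix f id = Y := by
    ext a b
    rw [Matrix.submatrix_apply, Matrix.mul_apply_eq_vecMul, hf, Matrix.single_one_vecMul]
    rfl
  refine le_antisymm (Matrix.rank_mul_le_right Z Y) ?_
  calc Y.rank = ((Z * Y).submatrix f id).rank := by rw [hY]
    _ ≤ (Z * Y).rank := Matrix.rank_submatrix_le _ f id

section PartialProducts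

variable {d : ℕ} (r : Fin (d + 1) → ℕ)
  (M : ∀ j : Fin d, Matrix (Fin (r j.castSucc)) (Fin (r j.succ)) ℂ)

theorem prefixProdC_zero : prefixProdC r M 0 = 1 := rfl

theorem prefixProdC_succ (j : Fin d) :
    prefixProdC r M j.succ = prefixProdC r M j.castSucc * M j := rfl

theorem suffixProdC_last : suffixProdC r M (Fin.last d) = 1 := by
  simp [suffixProdC]

theorem suffixProdC_castSucc (j : Fin d) :
    suffixProdC r M j.castSucc = M j * suffixProdC r M j.succ := by
  simp [suffixProdC]

theorem prefixProdC_mul_suffixProdC (k : Fin (d + 1)) :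
    prefixProdC r M k * suffixProdC r M k = suffixProdC r M 0 := by
  induction k using Fin.induction with
  | zero => rw [prefixProdC_zero, Matrix.one_mul]
  | succ j ih => rw [prefixProdC_succ, Matrix.mul_assoc, ← suffixProdC_castSucc, ih]

variable {r M} in
theorem prefixProdC_congr
    {N : ∀ j : Fin d, Matrix (Fin (r j.castSucc)) (Fin (r j.succ)) ℂ} (k : Fin (d + 1))
    (h : ∀ j : Fin d, (j : ℕ) < k → M j = N j) : prefixProdC r M k = prefixProdC r N k := by
  induction k using Fin.induction with
  | zero => rfl
  | succ j ih =>
    rw [prefixProdC_succ, prefixProdC_succ, h j (by simp),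
      ih fun i hi => h i (by simp at hi ⊢; omega)]

variable {r M} in
theorem suffixProdC_congr
    {N : ∀ j : Fin d, Matrix (Fin (r j.castSucc)) (Fin (r j.succ)) ℂ} (k : Fin (d + 1))
    (h : ∀ j : Fin d, (k : ℕ) ≤ j → M j = N j) : suffixProdC r M k = suffixProdC r N k := by
  induction k using Fin.reverseInduction with
  | last => rw [suffixProdC_last, suffixProdC_last]
  | cast j ih =>
    rw [suffixProdC_castSucc, suffixProdC_castSucc, h j (by simp),
      ih fun i hi => h i (by simp at hi ⊢; omega)]

/-- A row of a partial left product of matrices whose rows are zero or standard basis vectors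
is itself zero or a standard basis vector. -/
theorem prefixProdC_row_eq_zero_or_single (k : Fin (d + 1))
    (h : ∀ j : Fin d, (j : ℕ) < k → ∀ x, M j x = 0 ∨ ∃ y, M j x = Pi.single y 1)
    (x : Fin (r 0)) :
    prefixProdC r M k x = 0 ∨ ∃ y, prefixProdC r M k x = Pi.single y 1 := by
  induction k using Fin.induction with
  | zero => exact Or.inr ⟨x, funext fun y => by
      rw [prefixProdC_zero, Matrix.one_apply, Pi.single_apply]; simp only [eq_comm]⟩
  | succ j ih =>
    rw [prefixProdC_succ, Matrix.mul_apply_eq_vecMul]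
    rcases ih fun i hi => h i (by simp at hi ⊢; omega) with h0 | ⟨y, hy⟩
    · exact Or.inl (by rw [h0, Matrix.zero_vecMul])
    · rw [hy, Matrix.single_one_vecMul]
      exact h j (by simp) y

end PartialProducts

theorem suffixProdC_succ_eq_tail {d : ℕ} (r : Fin (d + 2) → ℕ)
    (M : ∀ j : Fin (d + 1), Matrix (Fin (r j.castSucc)) (Fin (r j.succ)) ℂ)
    (k : Fin (d + 1)) :
    suffixProdC r M k.succ = suffixProdC (fun j => r j.succ) (fun j => M j.succ) k := by
  induction k using Fin.reverseInduction with
  | last => rw [suffixProdC_last]; exact suffixProdC_last r M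
  | cast j ih =>
    rw [suffixProdC_castSucc, ← ih]
    exact suffixProdC_castSucc r M j.succ

/-- The sum over all index paths of the products of entries, weighted by a function of the
initial index, computed through the ordered matrix product. -/
theorem sum_path_prod_eq_sum_suffixProdC {d : ℕ} (r : Fin (d + 1) → ℕ)
    (M : ∀ j : Fin d, Matrix (Fin (r j.castSucc)) (Fin (r j.succ)) ℂ)
    (f : Fin (r 0) → ℂ) :
    ∑ α : ∀ j, Fin (r j), f (α 0) * ∏ j : Fin d, M j (α j.castSucc) (α j.succ) =
      ∑ b, Matrix.vecMul f (suffixProdC r M 0) b := by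
  induction d with
  | zero =>
    have h : Matrix.vecMul f (suffixProdC r M 0) = f :=
      (congrArg (Matrix.vecMul f) (suffixProdC_last r M)).trans (Matrix.vecMul_one f)
    rw [h]
    simp only [Finset.univ_eq_empty, Finset.prod_empty, mul_one]
    exact Fintype.sum_equiv (Equiv.piUnique fun j : Fin 1 => Fin (r j)) _ _ fun _ => rfl
  | succ d ih =>
    have h : suffixProdC r M 0 =
        M 0 * suffixProdC (fun j => r j.succ) (fun j => M j.succ) 0 := by
      rw [← suffixProdC_succ_eq_tail]
      exact suffixProdC_castSucc r M 0
    have hv : Matrix.vecMul f (suffixProdC r M 0) = Matrix.vecMul (Matrix.vecMul f (M 0))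
        (suffixProdC (fun j => r j.succ) (fun j => M j.succ) 0) := by
      rw [h]
      exact (Matrix.vecMul_vecMul f (M 0) _).symm
    rw [hv]
    refine Eq.trans ?_ (ih (fun j => r j.succ) (fun j => M j.succ) (Matrix.vecMul f (M 0)))
    rw [← (Fin.consEquiv fun j => Fin (r j)).sum_comp, Fintype.sum_prod_type,
      Finset.sum_comm]
    refine Finset.sum_congr rfl fun β _ => ?_
    simp only [Matrix.vecMul, dotProduct, Finset.sum_mul]
    refine Finset.sum_congr rfl fun a _ => ?_
    rw [Fin.prod_univ_succ, ← mul_assoc]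
    rfl

/-- The unfolding of a tensor with a TT-decomposition factors through the partial left and
right products of the cores. -/
theorem unfolding_eq_prefixProdC_mul_suffixProdC {d : ℕ} {n : Fin d → ℕ} (hn : ∀ j, 0 < n j)
    {r : Fin (d + 1) → ℕ} (hr0 : r 0 = 1) (hrd : r (Fin.last d) = 1)
    {G : ∀ j : Fin d, Fin (n j) → Matrix (Fin (r j.castSucc)) (Fin (r j.succ)) ℂ}
    {T : (∀ j : Fin d, Fin (n j)) → ℂ}
    (hT : ∀ i, T i = ∑ α : ∀ j : Fin (d + 1), Fin (r j),
      ∏ j : Fin d, G j (i j) (α j.castSucc) (α j.succ))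
    (k : Fin (d + 1))
    (iL : ∀ j : {j : Fin d // (j : ℕ) < k}, Fin (n j.1))
    (iR : ∀ j : {j : Fin d // (k : ℕ) ≤ j}, Fin (n j.1)) :
    (T fun j => if h : (j : ℕ) < k then iL ⟨j, h⟩ else iR ⟨j, by omega⟩) =
      ∑ β, prefixProdC r (fun j => G j (if h : (j : ℕ) < k then iL ⟨j, h⟩ else ⟨0, hn j⟩))
          k ⟨0, by omega⟩ β *
        suffixProdC r (fun j => G j (if h : (k : ℕ) ≤ j then iR ⟨j, h⟩ else ⟨0, hn j⟩))
          k β ⟨0, by omega⟩ := by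
  set i : ∀ j, Fin (n j) :=
    fun j => if h : (j : ℕ) < k then iL ⟨j, h⟩ else iR ⟨j, by omega⟩ with hi
  have hP := prefixProdC_congr (r := r) (M := fun j => G j (i j))
    (N := fun j => G j (if h : (j : ℕ) < k then iL ⟨j, h⟩ else ⟨0, hn j⟩)) k
    fun j hj => by simp [hi, hj]
  have hS := suffixProdC_congr (r := r) (M := fun j => G j (i j))
    (N := fun j => G j (if h : (k : ℕ) ≤ j then iR ⟨j, h⟩ else ⟨0, hn j⟩)) k
    fun j hj => by simp [hi, hj, hj.not_gt]
  rw [← hP, ← hS, ← Matrix.mul_apply, prefixProdC_mul_suffixProdC, hT]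
  have h := sum_path_prod_eq_sum_suffixProdC r (fun j => G j (i j)) 1
  simp only [Pi.one_apply, one_mul] at h
  rw [h, Fintype.sum_eq_single ⟨0, by omega⟩ fun b hb => absurd (Fin.ext (by simp; omega)) hb,
    Matrix.vecMul, dotProduct,
    Fintype.sum_eq_single ⟨0, by omega⟩ fun b hb => absurd (Fin.ext (by simp; omega)) hb]
  simp

/-- if the first `k` cores have rows that are zero or standard basis row
vectors, the matrix `Z_k` of partial left products has no zero column, and the matrix
`Y_k` of partial right products has rank `r_k`, then the `k`-th unfolding of `T` has
rank exactly `r_k`; in particular every TT-decomposition of `T` has `k`-th rank at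
least `r_k`. -/
theorem stmt3 (d : ℕ) (hd : 2 ≤ d) (n : Fin d → ℕ) (hn : ∀ j, 0 < n j)
    (r : Fin (d + 1) → ℕ) (hrpos : ∀ j, 0 < r j)
    (hr0 : r 0 = 1) (hrd : r (Fin.last d) = 1)
    (G : ∀ j : Fin d, Fin (n j) → Matrix (Fin (r j.castSucc)) (Fin (r j.succ)) ℂ)
    (T : (∀ j : Fin d, Fin (n j)) → ℂ)
    (hT : ∀ i, T i = ∑ α : ∀ j : Fin (d + 1), Fin (r j),
      ∏ j : Fin d, G j (i j) (α j.castSucc) (α j.succ))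
    (k : ℕ) (hk1 : 1 ≤ k) (hk2 : k ≤ d - 1)
    (hrows : ∀ j : Fin d, (j : ℕ) < k → ∀ (ij : Fin (n j)) (x : Fin (r j.castSucc)),
      (∀ y, G j ij x y = 0) ∨ (∃ y0, G j ij x y0 = 1 ∧ ∀ y, y ≠ y0 → G j ij x y = 0))
    (Zk : Matrix (∀ j : {j : Fin d // (j : ℕ) < k}, Fin (n j.1))
      (Fin (r ⟨k, by omega⟩)) ℂ)
    (hZk : ∀ iL α, Zk iL α =
      prefixProdC r (fun j => G j (if h : (j : ℕ) < k then iL ⟨j, h⟩ else ⟨0, hn j⟩))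
        ⟨k, by omega⟩ ⟨0, by omega⟩ α)
    (hZcols : ∀ α, ∃ iL, Zk iL α ≠ 0)
    (Yk : Matrix (Fin (r ⟨k, by omega⟩))
      (∀ j : {j : Fin d // k ≤ (j : ℕ)}, Fin (n j.1)) ℂ)
    (hYk : ∀ α iR, Yk α iR =
      suffixProdC r (fun j => G j (if h : k ≤ (j : ℕ) then iR ⟨j, h⟩ else ⟨0, hn j⟩))
        ⟨k, by omega⟩ α ⟨0, by omega⟩)
    (hYrank : Yk.rank = r ⟨k, by omega⟩)
    (U : Matrix (∀ j : {j : Fin d // (j : ℕ) < k}, Fin (n j.1))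
      (∀ j : {j : Fin d // k ≤ (j : ℕ)}, Fin (n j.1)) ℂ)
    (hU : ∀ iL iR, U iL iR =
      T fun j => if h : (j : ℕ) < k then iL ⟨j, h⟩ else iR ⟨j, by omega⟩) :
    U.rank = r ⟨k, by omega⟩ ∧
    ∀ r' : Fin (d + 1) → ℕ, IsTTDecomp n r' T → r ⟨k, by omega⟩ ≤ r' ⟨k, by omega⟩ := by
  have hUZY : U = Zk * Yk := by
    ext iL iR
    rw [hU, Matrix.mul_apply]
    simp only [hZk, hYk]
    exact unfolding_eq_prefixProdC_mul_suffixProdC hn hr0 hrd hT ⟨k, by omega⟩ iL iR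
  have hZrow : ∀ iL, Zk iL = 0 ∨ ∃ y, Zk iL = Pi.single y 1 := by
    intro iL
    rw [funext (hZk iL)]
    refine prefixProdC_row_eq_zero_or_single r _ ⟨k, by omega⟩ (fun j hj x => ?_) _
    rcases hrows j hj (if h : (j : ℕ) < k then iL ⟨j, h⟩ else ⟨0, hn j⟩) x with h | ⟨y, h1, h0⟩
    · exact Or.inl (funext h)
    · refine Or.inr ⟨y, funext fun z => ?_⟩
      by_cases hz : z = y
      · rw [hz, h1, Pi.single_eq_same]
      · rw [h0 z hz, Pi.single_eq_of_ne hz]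
  have hZsel : ∀ α, ∃ iL, Zk iL = Pi.single α 1 := by
    intro α
    obtain ⟨iL, h⟩ := hZcols α
    rcases hZrow iL with h0 | ⟨y, hy⟩
    · exact absurd (congrFun h0 α) h
    · refine ⟨iL, ?_⟩
      rw [hy] at h ⊢
      rw [show α = y from by_contra fun hne => h (Pi.single_eq_of_ne hne _)]
  choose f hf using hZsel
  have hUrank : U.rank = r ⟨k, by omega⟩ := by
    rw [hUZY, Matrix.rank_mul_eq_right_of_rows_single Zk Yk f hf, hYrank]
  refine ⟨hUrank, ?_⟩
  rintro r' ⟨hr0', hrd', G', hT'⟩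
  let Z' : Matrix (∀ j : {j : Fin d // (j : ℕ) < k}, Fin (n j.1))
      (Fin (r' ⟨k, by omega⟩)) ℂ := fun iL β => prefixProdC r'
    (fun j => G' j (if h : (j : ℕ) < k then iL ⟨j, h⟩ else ⟨0, hn j⟩))
    ⟨k, by omega⟩ ⟨0, by omega⟩ β
  let Y' : Matrix (Fin (r' ⟨k, by omega⟩))
      (∀ j : {j : Fin d // k ≤ (j : ℕ)}, Fin (n j.1)) ℂ := fun β iR => suffixProdC r'
    (fun j => G' j (if h : k ≤ (j : ℕ) then iR ⟨j, h⟩ else ⟨0, hn j⟩))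
    ⟨k, by omega⟩ β ⟨0, by omega⟩
  have hU' : U = Z' * Y' := by
    ext iL iR
    rw [hU, Matrix.mul_apply]
    exact unfolding_eq_prefixProdC_mul_suffixProdC hn hr0' hrd' hT' ⟨k, by omega⟩ iL iR
  calc r ⟨k, by omega⟩ = (Z' * Y').rank := by rw [← hU', hUrank]
    _ ≤ Z'.rank := Matrix.rank_mul_le_left Z' Y'
    _ ≤ Fintype.card (Fin (r' ⟨k, by omega⟩)) := Matrix.rank_le_card_width Z'
    _ = r' ⟨k, by omega⟩ := Fintype.card_fin _
end

section
/- Let d ≥ 1 and let t be an integer with 0 ≤ t < 2^d, with binary digits b_1,…,b_d ∈ {0,1} (b_1 most significant), i.e. t = Σ_{j=1}^{d} b_j · 2^{d−j}. For each k define 2×2 real matrices: if b_k = 0, set M_k(0) = [[1,0],[0,1]] and M_k(1) = [[0,1],[0,1]]; if b_k = 1, set M_k(0) = [[0,0],[0,1]] and M_k(1) = [[1,0],[0,1]]. Then for all i_1,…,i_d ∈ {0,1}: (1, 0) · M_1(i_1) · M_2(i_2) ⋯ M_d(i_d) · (0, 1)ᵀ = 1 if Σ_{j=1}^{d} i_j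 · 2^{d−j} > t, and = 0 if Σ_{j=1}^{d} i_j · 2^{d−j} ≤ t. In particular, the step-function tensor in quantized tensor-train format admits a TT-decomposition with all ranks equal to 2. -/
/-- An entry of a product of square matrices is a sum over paths between its two indices. -/
theorem Matrix.list_ofFn_prod_apply {m R : Type*} [Fintype m] [DecidableEq m] [CommSemiring R]
    {d : ℕ} (A : Fin d → Matrix m m R) (x y : m) :
    (List.ofFn A).prod x y = ∑ β : Fin (d + 1) → m,
      if β 0 = x ∧ β (Fin.last d) = y then ∏ j, A j (β j.castSucc) (β j.succ) else 0 := by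
  induction d generalizing x with
  | zero =>
    rw [← (Equiv.funUnique (Fin 1) m).symm.sum_comp]
    simp [Matrix.one_apply, ite_and]
  | succ d ih =>
    rw [List.ofFn_succ, List.prod_cons, Matrix.mul_apply,
      ← (Fin.consEquiv fun _ : Fin (d + 2) => m).sum_comp, Fintype.sum_prod_type]
    refine Eq.trans ?_ (Finset.sum_eq_single x ?_ ?_).symm
    · simp_rw [ih, Finset.mul_sum]
      rw [Finset.sum_comm]
      refine Finset.sum_congr rfl fun β _ => ?_
      rw [Finset.sum_eq_single (β 0)]
      · simp [Fin.consEquiv, Fin.prod_univ_succ, ← Fin.succ_last]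
      · intro z _ hz
        simp [hz.symm]
      · simp
    · intro z _ hz
      simp [Fin.consEquiv, hz]
    · simp

theorem Fin.sum_mul_two_pow_succ {d : ℕ} (b : Fin (d + 1) → Fin 2) :
    ∑ j : Fin (d + 1), (b j : ℕ) * 2 ^ (d + 1 - 1 - (j : ℕ)) =
      (b 0 : ℕ) * 2 ^ d + ∑ j : Fin d, (b j.succ : ℕ) * 2 ^ (d - 1 - (j : ℕ)) := by
  rw [Fin.sum_univ_succ]
  congr 1
  refine Finset.sum_congr rfl fun j _ => ?_
  congr 2
  simp only [Fin.val_succ]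
  omega

theorem Fin.sum_mul_two_pow_lt {d : ℕ} (b : Fin d → Fin 2) :
    ∑ j : Fin d, (b j : ℕ) * 2 ^ (d - 1 - (j : ℕ)) < 2 ^ d := by
  induction d with
  | zero => simp
  | succ d ih =>
    rw [Fin.sum_mul_two_pow_succ, pow_succ]
    have h := ih fun j => b j.succ
    have h0 : (b 0 : ℕ) * 2 ^ d ≤ 1 * 2 ^ d := Nat.mul_le_mul_right _ (by omega)
    omega

/-- The product of the step-function cores: the first row decides whether the digits `i` exceed the
digits `b`, and the second row is the absorbing state. -/
theorem stepCores_prod_apply {d : ℕ} (b : Fin d → Fin 2)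
    (M : Fin d → Fin 2 → Matrix (Fin 2) (Fin 2) ℝ)
    (hM0 : ∀ k, b k = 0 → M k 0 = !![1, 0; 0, 1] ∧ M k 1 = !![0, 1; 0, 1])
    (hM1 : ∀ k, b k = 1 → M k 0 = !![0, 0; 0, 1] ∧ M k 1 = !![1, 0; 0, 1])
    (i : Fin d → Fin 2) :
    (List.ofFn fun j => M j (i j)).prod 0 1 =
        (if ∑ j : Fin d, (b j : ℕ) * 2 ^ (d - 1 - (j : ℕ)) <
          ∑ j : Fin d, (i j : ℕ) * 2 ^ (d - 1 - (j : ℕ)) then 1 else 0) ∧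
      (List.ofFn fun j => M j (i j)).prod 1 1 = 1 := by
  induction d with
  | zero => simp
  | succ d ih =>
    obtain ⟨h01, h11⟩ := ih (fun j => b j.succ) (fun j => M j.succ) (fun k => hM0 k.succ)
      (fun k => hM1 k.succ) (fun j => i j.succ)
    have hb := Fin.sum_mul_two_pow_lt fun j => b j.succ
    have hi := Fin.sum_mul_two_pow_lt fun j => i j.succ
    rw [Fin.sum_mul_two_pow_succ, Fin.sum_mul_two_pow_succ, List.ofFn_succ, List.prod_cons,
      Matrix.mul_apply, Matrix.mul_apply, Fin.sum_univ_two, Fin.sum_univ_two, h01, h11]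
    have hfin : ∀ x : Fin 2, x = 0 ∨ x = 1 := by decide
    rcases hfin (b 0) with hb0 | hb0 <;> rcases hfin (i 0) with hi0 | hi0
    · simp [hb0, hi0, (hM0 0 hb0).1]
    · simp [hb0, hi0, (hM0 0 hb0).2]
      omega
    · simp [hb0, hi0, (hM1 0 hb0).1]
      omega
    · simp [hb0, hi0, (hM1 0 hb0).2]

/-- An entry of a product of `2 × 2` matrices depending on one digit each is a tensor in TT format
whose interior ranks are all `2`. -/
theorem exists_isTTDecomp_of_prod_apply {d : ℕ} (hd : 1 ≤ d)
    (M : Fin d → Fin 2 → Matrix (Fin 2) (Fin 2) ℂ) (x y : Fin 2) :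
    ∃ r : Fin (d + 1) → ℕ,
      IsTTDecomp (fun _ => 2) r
        (fun i : ∀ _ : Fin d, Fin 2 => (List.ofFn fun j => M j (i j)).prod x y) ∧
      ∀ j : Fin (d + 1), 1 ≤ (j : ℕ) → (j : ℕ) ≤ d - 1 → r j = 2 := by
  let r : Fin (d + 1) → ℕ := fun j => if j = 0 ∨ j = Fin.last d then 1 else 2
  have hr : ∀ j, r j ≤ 2 := fun j => by simp only [r]; split_ifs <;> omega
  have hne : Fin.last d ≠ 0 := by simp [Fin.ext_iff]; omega
  let e : ∀ j, Fin (r j) → Fin 2 := fun j a =>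
    if j = 0 then x else if j = Fin.last d then y else a.castLE (hr j)
  have he : ∀ j, Function.Injective (e j) := by
    intro j a c h
    by_cases hj : j = 0 ∨ j = Fin.last d
    · have h1 : r j = 1 := if_pos hj
      ext
      omega
    · rw [not_or] at hj
      simpa [e, hj.1, hj.2] using h
  refine ⟨r, ⟨by simp [r], by simp [r],
    fun j k a c => M j k (e j.castSucc a) (e j.succ c), fun i => ?_⟩, fun j h1 h2 => ?_⟩
  · refine (Matrix.list_ofFn_prod_apply _ x y).trans (Eq.symm ?_)
    refine Finset.sum_of_injOn (fun α j => e j (α j)) ?_ (by simp) ?_ ?_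
    · intro α _ β _ h
      funext j
      exact he j (congrFun h j)
    · intro β _ hβ
      refine if_neg fun ⟨h0, hl⟩ => hβ ?_
      have hsurj : ∀ j, ∃ a, e j a = β j := by
        intro j
        by_cases hj0 : j = 0
        · subst hj0
          exact ⟨⟨0, by simp [r]⟩, by simp [e, h0]⟩
        by_cases hjl : j = Fin.last d
        · subst hjl
          exact ⟨⟨0, by simp [r]⟩, by simp [e, hl, hne]⟩
        · have h2 : r j = 2 := if_neg (not_or.2 ⟨hj0, hjl⟩)
          exact ⟨⟨β j, by omega⟩, by simp [e, hj0, hjl]⟩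
      choose α hα using hsurj
      exact ⟨α, by simp, funext hα⟩
    · intro α _
      simp [e, hne]
  · refine if_neg ?_
    simp only [Fin.ext_iff, Fin.val_zero, Fin.val_last]
    omega

/-- explicit rank-2 QTT cores for the step function tensor. -/
theorem stmt4 (d : ℕ) (hd : 1 ≤ d) (t : ℕ) (ht : t < 2 ^ d) (b : Fin d → Fin 2)
    (htb : t = ∑ j : Fin d, (b j : ℕ) * 2 ^ (d - 1 - (j : ℕ)))
    (M : Fin d → Fin 2 → Matrix (Fin 2) (Fin 2) ℝ)
    (hM0 : ∀ k, b k = 0 → M k 0 = !![1, 0; 0, 1] ∧ M k 1 = !![0, 1; 0, 1])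
    (hM1 : ∀ k, b k = 1 → M k 0 = !![0, 0; 0, 1] ∧ M k 1 = !![1, 0; 0, 1]) :
    (∀ i : Fin d → Fin 2,
      ((List.ofFn fun j : Fin d => M j (i j)).prod) 0 1 =
        if t < ∑ j : Fin d, (i j : ℕ) * 2 ^ (d - 1 - (j : ℕ)) then 1 else 0) ∧
    ∃ r : Fin (d + 1) → ℕ,
      IsTTDecomp (fun _ => 2) r
        (fun i : ∀ _ : Fin d, Fin 2 =>
          if t < ∑ j : Fin d, (i j : ℕ) * 2 ^ (d - 1 - (j : ℕ)) then 1 else 0) ∧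
      ∀ j : Fin (d + 1), 1 ≤ (j : ℕ) → (j : ℕ) ≤ d - 1 → r j = 2 := by
  have hprod : ∀ i : Fin d → Fin 2, ((List.ofFn fun j : Fin d => M j (i j)).prod) 0 1 =
      if t < ∑ j : Fin d, (i j : ℕ) * 2 ^ (d - 1 - (j : ℕ)) then 1 else 0 := fun i => by
    rw [htb]
    exact (stepCores_prod_apply b M hM0 hM1 i).1
  refine ⟨hprod, ?_⟩
  convert exists_isTTDecomp_of_prod_apply hd (fun j k => (M j k).map Complex.ofRealHom) 0 1
    using 5 with r i
  have h := congrArg Complex.ofRealHom (hprod i)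
  rw [Matrix.list_ofFn_prod_apply] at h ⊢
  simpa [apply_ite] using h.symm
end

section
/- Let d ≥ 1 and let I : (Fin d)^d → ℂ be the indicator tensor of order d with all mode sizes equal to d defined by I(i_1,…,i_d) = 1 if the indices i_1,…,i_d are pairwise distinct and I(i_1,…,i_d) = 0 otherwise. Then I admits a TT-decomposition with ranks r_0 = r_d = 1 and r_k = binomial(d, k) for 1 ≤ k ≤ d−1. -/
/-- The set of values taken by `i` strictly before position `j`. -/
def valuesBefore {β : Type*} [DecidableEq β] {d : ℕ} (i : Fin d → β) (j : Fin (d + 1)) :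
    Finset β :=
  (Finset.univ.filter fun k : Fin d => k.castSucc < j).image i

lemma mem_valuesBefore {β : Type*} [DecidableEq β] {d : ℕ} {i : Fin d → β} {j : Fin (d + 1)}
    {b : β} : b ∈ valuesBefore i j ↔ ∃ k : Fin d, k.castSucc < j ∧ i k = b := by
  simp [valuesBefore]

lemma valuesBefore_zero {β : Type*} [DecidableEq β] {d : ℕ} (i : Fin d → β) :
    valuesBefore i 0 = ∅ := by
  simp [valuesBefore]

lemma valuesBefore_succ {β : Type*} [DecidableEq β] {d : ℕ} (i : Fin d → β) (j : Fin d) :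
    valuesBefore i j.succ = insert (i j) (valuesBefore i j.castSucc) := by
  ext b
  simp only [mem_valuesBefore, Finset.mem_insert, Fin.castSucc_lt_succ_iff,
    Fin.castSucc_lt_castSucc_iff, le_iff_eq_or_lt, or_and_right, exists_or, exists_eq_left,
    eq_comm (a := b)]

lemma injective_iff_notMem_valuesBefore {β : Type*} [DecidableEq β] {d : ℕ} {i : Fin d → β} :
    Function.Injective i ↔ ∀ j : Fin d, i j ∉ valuesBefore i j.castSucc := by
  simp only [mem_valuesBefore, Fin.castSucc_lt_castSucc_iff, not_exists, not_and]
  refine ⟨fun h j k hkj e => hkj.ne (h e), fun h a b e => ?_⟩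
  rcases lt_trichotomy a b with hab | hab | hab
  · exact (h b a hab e).elim
  · exact hab
  · exact (h a b hab e.symm).elim

lemma card_valuesBefore {β : Type*} [DecidableEq β] {d : ℕ} {i : Fin d → β}
    (hi : Function.Injective i) (j : Fin (d + 1)) : (valuesBefore i j).card = j := by
  induction j using Fin.induction with
  | zero => simp [valuesBefore_zero]
  | succ j ih =>
    rw [valuesBefore_succ,
      Finset.card_insert_of_notMem (injective_iff_notMem_valuesBefore.1 hi j), ih]
    simp

/-- A chain of sets that starts at `∅` and adds the new element `i j` at step `j` is the chain of
initial values of `i`, and exists only for injective `i`. -/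
lemma forall_insert_iff_eq_valuesBefore {β : Type*} [DecidableEq β] {d : ℕ} (i : Fin d → β)
    (A : Fin (d + 1) → Finset β) (hA : A 0 = ∅) :
    (∀ j : Fin d, i j ∉ A j.castSucc ∧ A j.succ = insert (i j) (A j.castSucc)) ↔
      Function.Injective i ∧ A = valuesBefore i := by
  constructor
  · intro h
    have hA' : A = valuesBefore i := by
      funext j
      induction j using Fin.induction with
      | zero => rw [hA, valuesBefore_zero]
      | succ j ih => rw [(h j).2, ih, valuesBefore_succ]
    subst hA'
    exact ⟨injective_iff_notMem_valuesBefore.2 fun j => (h j).1, rfl⟩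
  · rintro ⟨hi, rfl⟩ j
    exact ⟨injective_iff_notMem_valuesBefore.1 hi j, valuesBefore_succ i j⟩

/-- An enumeration of the `k`-element subsets of `Fin d`. -/
noncomputable def finChooseEquiv (d k : ℕ) :
    Fin (d.choose k) ≃ {s : Finset (Fin d) // s.card = k} :=
  (Fintype.equivFinOfCardEq (by simp)).symm

/-- the indicator tensor of pairwise distinct indices admits a
TT-decomposition with ranks `binomial d k`. -/
theorem stmt7 (d : ℕ) (hd : 1 ≤ d) :
    ∃ r : Fin (d + 1) → ℕ,
      IsTTDecomp (fun _ => d) r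
        (fun i : ∀ _ : Fin d, Fin d => if Function.Injective i then 1 else 0) ∧
      ∀ j : Fin (d + 1), r j = d.choose (j : ℕ) := by
  classical
  refine ⟨fun j => d.choose j, ⟨by simp, by simp, fun j x a b =>
    if x ∉ (finChooseEquiv d _ a).1 ∧
      (finChooseEquiv d _ b).1 = insert x (finChooseEquiv d _ a).1 then 1 else 0, ?_⟩,
    fun _ => rfl⟩
  intro i
  have key (α : ∀ j : Fin (d + 1), Fin (d.choose j)) :=
    forall_insert_iff_eq_valuesBefore i (fun j => (finChooseEquiv d j (α j)).1)
      (Finset.card_eq_zero.1 (finChooseEquiv d _ (α 0)).2)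
  simp only [Finset.prod_boole, Finset.mem_univ, true_implies]
  by_cases hi : Function.Injective i
  · let α₀ (j : Fin (d + 1)) : Fin (d.choose j) :=
      (finChooseEquiv d j).symm ⟨valuesBefore i j, card_valuesBefore hi j⟩
    rw [if_pos hi, Finset.sum_eq_single α₀]
    · rw [if_pos]
      exact (key α₀).2 ⟨hi, by simp [α₀]⟩
    · intro α _ hα
      refine if_neg fun h => hα ?_
      funext j
      rw [Equiv.eq_symm_apply]
      exact Subtype.ext (congrFun ((key α).1 h).2 j)
    · simp
  · rw [if_neg hi]
    exact (Finset.sum_eq_zero fun α _ => if_neg fun h => hi ((key α).1 h).1).symm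
end

section
/- The number of subsets S of {1, 2, …, 2000} whose element sum is divisible by 5 satisfies 5 · #{ S ⊆ {1,…,2000} : (Σ_{a ∈ S} a) ≡ 0 (mod 5) } = 2^2000 + 2^402; equivalently, this number of subsets equals (32^400 + 4 · 2^400)/5. -/
/-- The number of subsets of `{1, …, n}` whose element sum is congruent to `r` modulo `m`. -/
def subsetSumCount (m n : ℕ) (r : ZMod m) : ℕ :=
  ((Finset.Icc 1 n).powerset.filter fun S => ((∑ a ∈ S, a : ℕ) : ZMod m) = r).card

theorem subsetSumCount_zero (m : ℕ) (r : ZMod m) :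
    subsetSumCount m 0 r = if r = 0 then 1 else 0 := by
  split_ifs with h <;> simp [subsetSumCount, Finset.filter_singleton, h, eq_comm]

theorem subsetSumCount_succ (m n : ℕ) (r : ZMod m) :
    subsetSumCount m (n + 1) r =
      subsetSumCount m n r + subsetSumCount m n (r - ((n + 1 : ℕ) : ZMod m)) := by
  have hn : n + 1 ∉ Finset.Icc 1 n := by simp
  simp only [subsetSumCount, Finset.card_filter]
  rw [← Finset.insert_Icc_right_eq_Icc_add_one (by omega : 1 ≤ n + 1),
    Finset.sum_powerset_insert hn]
  congr 1
  refine Finset.sum_congr rfl fun S hS => ?_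
  rw [Finset.sum_insert fun h => hn (Finset.mem_powerset.mp hS h), Nat.cast_add]
  simp only [eq_sub_iff_add_eq, add_comm]

theorem five_mul_subsetSumCount_five_mul (k : ℕ) (r : ZMod 5) :
    5 * subsetSumCount 5 (5 * k) r + 2 ^ k = 32 ^ k + if r = 0 then 5 * 2 ^ k else 0 := by
  induction k generalizing r with
  | zero => rw [subsetSumCount_zero]; split_ifs <;> rfl
  | succ k ih =>
    have h5 : (5 : ZMod 5) = 0 := rfl
    have h0 := ih 0
    have h1 := ih 1
    have h2 := ih 2
    have h3 := ih 3
    have h4 := ih 4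
    rw [show 5 * (k + 1) = 5 * k + 1 + 1 + 1 + 1 + 1 by ring]
    simp only [subsetSumCount_succ, Nat.cast_add, Nat.cast_mul, Nat.cast_ofNat, Nat.cast_one, h5,
      zero_mul, zero_add, pow_succ]
    obtain rfl | rfl | rfl | rfl | rfl : r = 0 ∨ r = 1 ∨ r = 2 ∨ r = 3 ∨ r = 4 := by
      decide +revert
    all_goals
      simp +decide only [↓reduceIte] at h0 h1 h2 h3 h4 ⊢
      ring_nf at h0 h1 h2 h3 h4 ⊢
      reduce_mod_char
      omega

/-- the number of subsets of {1,…,2000} whose element sum is divisible by 5. -/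
theorem stmt8 :
    5 * ((Finset.Icc 1 2000).powerset.filter fun S => (∑ a ∈ S, a) % 5 = 0).card =
        2 ^ 2000 + 2 ^ 402 ∧
    ((Finset.Icc 1 2000).powerset.filter fun S => (∑ a ∈ S, a) % 5 = 0).card =
        (32 ^ 400 + 4 * 2 ^ 400) / 5 := by
  have h := five_mul_subsetSumCount_five_mul 400 0
  simp only [subsetSumCount, ZMod.natCast_eq_zero_iff, Nat.dvd_iff_mod_eq_zero, if_true,
    Nat.reduceMul] at h
  have h32 : (32 : ℕ) ^ 400 = 2 ^ 2000 := by rw [show 32 = 2 ^ 5 by rfl, ← pow_mul]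
  have h402 : (2 : ℕ) ^ 402 = 4 * 2 ^ 400 := by rw [pow_add 2 400 2, mul_comm, show 2 ^ 2 = 4 by rfl]
  rw [h402, ← h32]
  generalize (32 : ℕ) ^ 400 = x at *
  generalize (2 : ℕ) ^ 400 = y at *
  omega
end

section
/- Let d ≥ 1, 1 ≤ l ≤ d, let a_k : Fin n_k → ℝ for k = 1,…,d, and let P : ℝ → ℂ be any function. Consider the tensor T(i_1,…,i_d) = P(a_1(i_1) + a_2(i_2) + ⋯ + a_d(i_d)). For 1 ≤ j ≤ l−1 let S_j = { Σ_{k=1}^{j} a_k(i_k) : i_k ∈ Fin n_k } be the (finite) set of attainable left partial sums, and for l ≤ j ≤ d−1 let S_j = { Σ_{k=j+1}^{d} a_k(i_k) : i_k ∈ Fin n_k } be the set of attainable right partial sums. Then T admits a TT-decomposition with ranks r_j ≤ |S_j| for 1 ≤ j ≤ d−1. -/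
open Finset in
theorem sum_filter_val_lt_succ {d : ℕ} (f : Fin d → ℝ) (j : Fin d) :
    ∑ k ∈ univ.filter (fun k : Fin d => (k : ℕ) < j + 1), f k =
      ∑ k ∈ univ.filter (fun k : Fin d => (k : ℕ) < j), f k + f j := by
  have h : univ.filter (fun k : Fin d => (k : ℕ) < j + 1) =
      insert j (univ.filter fun k : Fin d => (k : ℕ) < j) := by
    ext k
    simp only [mem_filter, mem_univ, true_and, mem_insert, Fin.ext_iff]
    omega
  rw [h, sum_insert (by simp), add_comm]

open Finset in
theorem sum_filter_le_val {d : ℕ} (f : Fin d → ℝ) (j : Fin d) :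
    ∑ k ∈ univ.filter (fun k : Fin d => (j : ℕ) ≤ k), f k =
      f j + ∑ k ∈ univ.filter (fun k : Fin d => (j : ℕ) + 1 ≤ k), f k := by
  have h : univ.filter (fun k : Fin d => (j : ℕ) ≤ k) =
      insert j (univ.filter fun k : Fin d => (j : ℕ) + 1 ≤ k) := by
    ext k
    simp only [mem_filter, mem_univ, true_and, mem_insert, Fin.ext_iff]
    omega
  rw [h, sum_insert (by simp)]

open Finset in
theorem sum_filter_val_lt_add_sum_filter_le_val {d : ℕ} (f : Fin d → ℝ) (j : ℕ) :
    ∑ k ∈ univ.filter (fun k : Fin d => (k : ℕ) < j), f k +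
      ∑ k ∈ univ.filter (fun k : Fin d => j ≤ (k : ℕ)), f k = ∑ k, f k := by
  simpa only [not_lt] using
    sum_filter_add_sum_filter_not univ (fun k : Fin d => (k : ℕ) < j) f

/-- If every bond `j` carries a state `s j i` which is trivial at both ends and is determined by its
left neighbour before site `m` and by its right neighbour after site `m`, then any tensor that only
depends on the mode index at `m` and the two adjacent states has a TT-decomposition whose ranks are
the numbers of attainable states. -/
theorem isTTDecomp_of_state {d : ℕ} (n : Fin d → ℕ) (hn : ∀ j, 0 < n j)
    (s : Fin (d + 1) → (∀ k : Fin d, Fin (n k)) → ℝ) (m : Fin d)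
    (F : ∀ j : Fin d, Fin (n j) → ℝ → ℝ) (Q : Fin (n m) → ℝ → ℝ → ℂ)
    (h0 : ∀ i, s 0 i = 0) (hlast : ∀ i, s (Fin.last d) i = 0)
    (hleft : ∀ j < m, ∀ i, s j.succ i = F j (i j) (s j.castSucc i))
    (hright : ∀ j > m, ∀ i, s j.castSucc i = F j (i j) (s j.succ i)) :
    IsTTDecomp n (fun j => (Set.range (s j)).ncard)
      (fun i => Q (i m) (s m.castSucc i) (s m.succ i)) := by
  classical
  have : ∀ j, Nonempty (Fin (n j)) := fun j => ⟨⟨0, hn j⟩⟩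
  have range_zero : ∀ j, (∀ i, s j i = 0) → (Set.range (s j)).ncard = 1 := by
    intro j hj
    rw [show s j = fun _ => (0 : ℝ) from funext hj, Set.range_const, Set.ncard_singleton]
  refine ⟨range_zero _ h0, range_zero _ hlast, ?_⟩
  have e : ∀ j, Fin (Set.range (s j)).ncard ≃ Set.range (s j) := fun j =>
    (Finite.equivFinOfCardEq (Nat.card_coe_set_eq _)).symm
  refine ⟨fun j x α β =>
    if h : j = m then Q (h ▸ x) (e _ α) (e _ β)
    else if j < m then (if (e _ β : ℝ) = F j x (e _ α) then 1 else 0)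
    else (if (e _ α : ℝ) = F j x (e _ β) then 1 else 0), fun i => ?_⟩
  rw [Finset.sum_eq_single (fun j => (e j).symm ⟨s j i, i, rfl⟩)]
  · rw [Finset.prod_eq_single m]
    · simp
    · intro j _ hj
      rcases lt_or_gt_of_ne hj with h | h
      · simp [hj, h, hleft j h i]
      · simp [hj, h.not_gt, hright j h i]
    · simp
  · intro α _ hα
    by_contra hne
    rw [← ne_eq, Finset.prod_ne_zero_iff] at hne
    have zero_of : ∀ j, (∀ i, s j i = 0) → (e j (α j) : ℝ) = s j i := by
      intro j hj
      obtain ⟨i', hi'⟩ := (e j (α j)).2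
      rw [← hi', hj, hj]
    have eq_left : ∀ j : Fin (d + 1), j ≤ m.castSucc → (e j (α j) : ℝ) = s j i := by
      intro j
      induction j using Fin.induction with
      | zero => exact fun _ => zero_of 0 h0
      | succ j ih =>
        intro hj
        have hjm : j < m := Fin.castSucc_lt_castSucc_iff.1 (Fin.castSucc_lt_iff_succ_le.2 hj)
        have hfac := hne j (Finset.mem_univ j)
        simp only [hjm.ne, hjm, dite_false, if_true] at hfac
        rw [hleft j hjm i, ← ih (Fin.castSucc_le_castSucc_iff.2 hjm.le)]
        by_contra hcon
        exact hfac (if_neg hcon)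
    have eq_right : ∀ j : Fin (d + 1), m.succ ≤ j → (e j (α j) : ℝ) = s j i := by
      intro j
      induction j using Fin.reverseInduction with
      | last => exact fun _ => zero_of _ hlast
      | cast j ih =>
        intro hj
        have hjm : m < j := Fin.castSucc_lt_castSucc_iff.1 (Fin.castSucc_lt_iff_succ_le.2 hj)
        have hfac := hne j (Finset.mem_univ j)
        simp only [hjm.ne', hjm.not_gt, dite_false, if_false] at hfac
        rw [hright j hjm i, ← ih (Fin.succ_le_succ_iff.2 hjm.le)]
        by_contra hcon
        exact hfac (if_neg hcon)
    refine hα (funext fun j => ?_)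
    rw [Equiv.eq_symm_apply]
    refine Subtype.ext ?_
    rcases le_or_gt j m.castSucc with h | h
    · exact eq_left j h
    · exact eq_right j (Fin.castSucc_lt_iff_succ_le.1 h)
  · simp

/-- the tensor `P(a_1(i_1) + ⋯ + a_d(i_d))` admits a TT-decomposition
whose ranks are bounded by the numbers of attainable left (resp. right) partial sums. -/
theorem stmt11 (d l : ℕ) (hd : 1 ≤ d) (hl1 : 1 ≤ l) (hld : l ≤ d)
    (n : Fin d → ℕ) (hn : ∀ j, 0 < n j)
    (a : ∀ k : Fin d, Fin (n k) → ℝ) (P : ℝ → ℂ) :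
    ∃ r : Fin (d + 1) → ℕ,
      IsTTDecomp n r (fun i => P (∑ k : Fin d, a k (i k))) ∧
      (∀ (j : ℕ) (hj1 : 1 ≤ j) (hj2 : j ≤ l - 1),
        r ⟨j, by omega⟩ ≤
          (Set.range fun i : ∀ k : Fin d, Fin (n k) =>
            ∑ k ∈ Finset.univ.filter fun k : Fin d => (k : ℕ) < j, a k (i k)).ncard) ∧
      (∀ (j : ℕ) (hj1 : l ≤ j) (hj2 : j ≤ d - 1),
        r ⟨j, by omega⟩ ≤
          (Set.range fun i : ∀ k : Fin d, Fin (n k) =>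
            ∑ k ∈ Finset.univ.filter fun k : Fin d => j ≤ (k : ℕ), a k (i k)).ncard) := by
  let s : Fin (d + 1) → (∀ k : Fin d, Fin (n k)) → ℝ := fun j i =>
    if (j : ℕ) < l then ∑ k ∈ Finset.univ.filter fun k : Fin d => (k : ℕ) < j, a k (i k)
    else ∑ k ∈ Finset.univ.filter fun k : Fin d => (j : ℕ) ≤ k, a k (i k)
  have s_left : ∀ (j : Fin (d + 1)) i, (j : ℕ) < l →
      s j i = ∑ k ∈ Finset.univ.filter fun k : Fin d => (k : ℕ) < j, a k (i k) :=
    fun j i h => if_pos h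
  have s_right : ∀ (j : Fin (d + 1)) i, l ≤ (j : ℕ) →
      s j i = ∑ k ∈ Finset.univ.filter fun k : Fin d => (j : ℕ) ≤ k, a k (i k) :=
    fun j i h => if_neg h.not_gt
  let m : Fin d := ⟨l - 1, by omega⟩
  have hm : (m : ℕ) + 1 = l := Nat.sub_add_cancel hl1
  refine ⟨fun j => (Set.range (s j)).ncard, ?_, ?_, ?_⟩
  · have total : ∀ i : (∀ k : Fin d, Fin (n k)),
        ∑ k, a k (i k) = s m.castSucc i + a m (i m) + s m.succ i := by
      intro i
      rw [s_left _ i (by simp; omega), s_right _ i (by simp; omega), Fin.val_castSucc,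
        Fin.val_succ, ← sum_filter_val_lt_succ (fun k => a k (i k)),
        sum_filter_val_lt_add_sum_filter_le_val]
    simp only [total]
    refine isTTDecomp_of_state n hn s m (fun j x t => t + a j x)
      (fun x t u => P (t + a m x + u)) ?_ ?_ ?_ ?_
    · intro i
      rw [s_left _ i (by simp; omega)]
      simp
    · intro i
      rw [s_right _ i (by simpa using hld)]
      refine Finset.sum_eq_zero fun k hk => absurd (Finset.mem_filter.1 hk).2 ?_
      simp
    · intro j hj i
      rw [Fin.lt_def] at hj
      rw [s_left _ i (by simp; omega), s_left _ i (by simp; omega), Fin.val_castSucc,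
        Fin.val_succ, sum_filter_val_lt_succ (fun k => a k (i k))]
    · intro j hj i
      rw [gt_iff_lt, Fin.lt_def] at hj
      rw [s_right _ i (by simp; omega), s_right _ i (by simp; omega), Fin.val_castSucc,
        Fin.val_succ, sum_filter_le_val (fun k => a k (i k)), add_comm]
  · intro j _ hj
    exact (congrArg (fun f => (Set.range f).ncard)
      (funext fun i => s_left ⟨j, by omega⟩ i (show j < l by omega))).le
  · intro j hj _
    exact (congrArg (fun f => (Set.range f).ncard)
      (funext fun i => s_right ⟨j, by omega⟩ i hj)).le
end

section
/- Let d ≥ 1, let w_1,…,w_d be nonnegative integers, and let W be a nonnegative integer. Consider the 0–1 knapsack indicator tensor T : {0,1}^d → ℂ defined by T(x_1,…,x_d) = 1 if Σ_{k=1}^{d} w_k x_k ≤ W and T(x_1,…,x_d) = 0 otherwise. Then T admits a TT-decomposition with all intermediate ranks r_j ≤ W + 1 for 1 ≤ j ≤ d−1. -/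
/-- The ranks of the knapsack TT-decomposition: `1` at both ends and `W + 1` in between. -/
def knapsackRank (d W : ℕ) (j : Fin (d + 1)) : ℕ :=
  if j = 0 ∨ j = Fin.last d then 1 else W + 1

/-- The transition relation of the knapsack automaton, whose state is the weight packed so far;
the last step only tests the capacity. -/
def knapsackStep (d W : ℕ) (j : Fin d) (v a b : ℕ) : Prop :=
  if j.succ = Fin.last d then a + v ≤ W else a + v = b

theorem partialSum_le_partialSum_last {d : ℕ} (v : Fin d → ℕ) (j : Fin (d + 1)) :
    Fin.partialSum v j ≤ Fin.partialSum v (Fin.last d) := by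
  have hmono : Monotone (Fin.partialSum v) :=
    Fin.monotone_iff_le_succ.2 fun i => by rw [Fin.partialSum_succ]; omega
  exact hmono (Fin.le_last j)

theorem partialSum_last_eq_sum {d : ℕ} (v : Fin d → ℕ) :
    Fin.partialSum v (Fin.last d) = ∑ k, v k := by
  simp [Fin.partialSum, List.sum_ofFn, List.take_of_length_le]

/-- The run of the knapsack automaton on the item weights `v`. -/
def knapsackRun {d : ℕ} (W : ℕ) (v : Fin d → ℕ) (j : Fin (d + 1)) : Fin (knapsackRank d W j) :=
  ⟨if j = Fin.last d then 0 else min (Fin.partialSum v j) W, by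
    unfold knapsackRank
    by_cases h0 : j = 0
    · subst h0; simp
    · by_cases hl : j = Fin.last d
      · simp [hl]
      · simp only [h0, hl, or_self, if_false]; omega⟩

theorem forall_knapsackStep_iff {d : ℕ} (hd : 1 ≤ d) (W : ℕ) (v : Fin d → ℕ)
    (α : ∀ j, Fin (knapsackRank d W j)) :
    (∀ j : Fin d, knapsackStep d W j (v j) (α j.castSucc) (α j.succ)) ↔
      α = knapsackRun W v ∧ ∑ k, v k ≤ W := by
  rw [← partialSum_last_eq_sum]
  have hlast : ∀ j : Fin d, j.castSucc ≠ Fin.last d := fun j => (Fin.castSucc_lt_last j).ne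
  have hle := partialSum_le_partialSum_last v
  constructor
  · intro h
    have hstate : ∀ j : Fin (d + 1), j ≠ Fin.last d → (α j : ℕ) = Fin.partialSum v j := by
      intro j
      induction j using Fin.induction with
      | zero =>
        intro _
        have := (α 0).isLt
        simp only [knapsackRank, true_or, if_true] at this
        rw [Fin.partialSum_zero]; omega
      | succ i ih =>
        intro hi
        have hs := h i
        rw [knapsackStep, if_neg hi, ih (hlast i)] at hs
        rw [← hs, Fin.partialSum_succ]
    have htotal : Fin.partialSum v (Fin.last d) ≤ W := by
      obtain ⟨m, rfl⟩ : ∃ m, d = m + 1 := ⟨d - 1, by omega⟩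
      have hs := h (Fin.last m)
      rw [knapsackStep, if_pos (Fin.succ_last m), hstate _ (hlast _)] at hs
      rwa [← Fin.succ_last, Fin.partialSum_succ]
    refine ⟨?_, htotal⟩
    funext j
    apply Fin.ext
    by_cases hj : j = Fin.last d
    · subst hj
      have := (α (Fin.last d)).isLt
      simp only [knapsackRank, or_true, if_true] at this
      simp only [knapsackRun, if_true]; omega
    · simp only [knapsackRun, if_neg hj, hstate j hj]
      have := hle j
      omega
  · rintro ⟨rfl, htotal⟩ j
    have hc := hle j.castSucc
    have hs := hle j.succ
    have hsucc := Fin.partialSum_succ v j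
    by_cases hj : j.succ = Fin.last d
    · simp only [knapsackStep, if_pos hj, knapsackRun, if_neg (hlast j)]
      omega
    · simp only [knapsackStep, knapsackRun, if_neg hj, if_neg (hlast j)]
      omega

/-- the 0–1 knapsack indicator tensor admits a TT-decomposition
with all intermediate ranks at most `W + 1`. -/
theorem stmt12 (d : ℕ) (hd : 1 ≤ d) (w : Fin d → ℕ) (W : ℕ) :
    ∃ r : Fin (d + 1) → ℕ,
      IsTTDecomp (fun _ => 2) r
        (fun x : ∀ _ : Fin d, Fin 2 =>
          if ∑ k : Fin d, w k * (x k : ℕ) ≤ W then 1 else 0) ∧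
      ∀ j : Fin (d + 1), 1 ≤ (j : ℕ) → (j : ℕ) ≤ d - 1 → r j ≤ W + 1 := by
  classical
  refine ⟨knapsackRank d W, ⟨by simp [knapsackRank], by simp [knapsackRank],
    fun j i => Matrix.of fun a b => if knapsackStep d W j (w j * i) a b then 1 else 0,
    fun x => ?_⟩, fun j _ _ => ?_⟩
  · simp only [Matrix.of_apply, Finset.prod_ite_zero, Finset.prod_const_one, Finset.mem_univ,
      true_imp_iff]
    simp only [forall_knapsackStep_iff hd W (fun k => w k * (x k : ℕ)), ite_and,
      Finset.sum_ite_eq', Finset.mem_univ, if_true]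
  · unfold knapsackRank
    split_ifs <;> omega
end

section
/- Let L ≥ 1, set d = 2L + 1, and let p : {0,1,…,d} → ℝ be any function. Consider the shoe-sale-game tensor T : {0,1}^d → ℂ defined by T(i_1,…,i_d) = p(Σ_{k=1}^{d} i_k) · min(Σ_{k=1}^{L} i_k, Σ_{k=L+1}^{d} i_k). Then T admits a TT-decomposition with ranks satisfying r_j ≤ min(j, d − j) + 1 for 1 ≤ j ≤ d − 1. -/
open Finset

/-- The core entries of the shoe-sale-game tensor: the left cores add the mode index to the
running prefix sum, the right cores add it to the suffix sum, and the middle core evaluates the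
game on the prefix sum `a`, the mode index `x` and the suffix sum `b`. -/
noncomputable def shoeCore (L : ℕ) (p : ℕ → ℝ) (j x a b : ℕ) : ℂ :=
  if j < L then if b = a + x then 1 else 0
  else if j = L then (p (a + x + b) : ℂ) * ((min a (x + b) : ℕ) : ℂ)
  else if a = b + x then 1 else 0

/-- The unique path of states contributing to the contraction of the cores `shoeCore`. -/
def shoePath (L : ℕ) (x : ℕ → ℕ) (j : ℕ) : ℕ :=
  if j ≤ L then ∑ k ∈ range j, x k else ∑ k ∈ Ico j (2 * L + 1), x k

lemma shoePath_le {L : ℕ} {x : ℕ → ℕ} (hx : ∀ k, x k ≤ 1) (j : ℕ) :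
    shoePath L x j ≤ min j (2 * L + 1 - j) := by
  unfold shoePath
  split_ifs with h
  · have : ∑ k ∈ range j, x k ≤ j := by
      simpa using sum_le_card_nsmul (range j) x 1 fun k _ => hx k
    omega
  · have : ∑ k ∈ Ico j (2 * L + 1), x k ≤ 2 * L + 1 - j := by
      simpa using sum_le_card_nsmul (Ico j (2 * L + 1)) x 1 fun k _ => hx k
    omega

lemma shoeCore_shoePath {L j : ℕ} (p : ℕ → ℝ) (x : ℕ → ℕ) (hj : j < 2 * L + 1) (hjL : j ≠ L) :
    shoeCore L p j (x j) (shoePath L x j) (shoePath L x (j + 1)) = 1 := by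
  unfold shoeCore shoePath
  rcases lt_or_gt_of_ne hjL with h | h
  · rw [if_pos h, if_pos h.le, if_pos (by omega : j + 1 ≤ L), sum_range_succ, if_pos rfl]
  · rw [if_neg h.not_gt, if_neg hjL, if_neg h.not_ge, if_neg (by omega : ¬j + 1 ≤ L),
      sum_eq_sum_Ico_succ_bot hj, if_pos (add_comm _ _)]

lemma eq_shoePath_of_shoeCore_ne_zero {L : ℕ} {p : ℕ → ℝ} {x a : ℕ → ℕ} (h0 : a 0 = 0)
    (hd : a (2 * L + 1) = 0)
    (h : ∀ j < 2 * L + 1, shoeCore L p j (x j) (a j) (a (j + 1)) ≠ 0)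
    {j : ℕ} (hj : j ≤ 2 * L + 1) : a j = shoePath L x j := by
  unfold shoePath
  split_ifs with hjL
  · induction j with
    | zero => simpa using h0
    | succ j ih =>
      have hj' := h j (by omega)
      rw [shoeCore, if_pos (by omega)] at hj'
      rw [sum_range_succ, ← ih (by omega) (by omega)]
      by_contra hne
      exact hj' (if_neg hne)
  · induction hj using Nat.decreasingInduction with
    | self => simpa using hd
    | of_succ j hj ih =>
      have hj' := h j hj
      rw [shoeCore, if_neg (by omega), if_neg (by omega)] at hj'
      rw [sum_eq_sum_Ico_succ_bot hj, ← ih (by omega), add_comm]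
      by_contra hne
      exact hj' (if_neg hne)

lemma shoeCore_middle (L : ℕ) (p : ℕ → ℝ) (x : ℕ → ℕ) :
    shoeCore L p L (x L) (shoePath L x L) (shoePath L x (L + 1)) =
      (p (∑ k ∈ range (2 * L + 1), x k) : ℂ) *
        ((min (∑ k ∈ range L, x k) (∑ k ∈ Ico L (2 * L + 1), x k) : ℕ) : ℂ) := by
  rw [shoeCore, if_neg (lt_irrefl L), if_pos rfl, shoePath, shoePath, if_pos le_rfl,
    if_neg (by omega), add_assoc, ← sum_eq_sum_Ico_succ_bot (by omega : L < 2 * L + 1),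
    sum_range_add_sum_Ico _ (by omega)]

/-- the shoe-sale-game tensor (d = 2L+1 binary players, value
`p(#coalition) · min(#left, #right)`) admits a TT-decomposition with ranks
`r_j ≤ min(j, d−j) + 1`. -/
theorem stmt13 (L : ℕ) (hL : 1 ≤ L) (p : ℕ → ℝ) :
    ∃ r : Fin (2 * L + 1 + 1) → ℕ,
      IsTTDecomp (fun _ => 2) r
        (fun i : ∀ _ : Fin (2 * L + 1), Fin 2 =>
          ((p (∑ k : Fin (2 * L + 1), (i k : ℕ)) : ℂ) *
            ((min
                (∑ k ∈ Finset.univ.filter fun k : Fin (2 * L + 1) => (k : ℕ) < L,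
                  (i k : ℕ))
                (∑ k ∈ Finset.univ.filter fun k : Fin (2 * L + 1) => L ≤ (k : ℕ),
                  (i k : ℕ)) : ℕ) : ℂ))) ∧
      ∀ j : Fin (2 * L + 1 + 1), 1 ≤ (j : ℕ) → (j : ℕ) ≤ 2 * L →
        r j ≤ min (j : ℕ) (2 * L + 1 - (j : ℕ)) + 1 := by
  refine ⟨fun j => min (j : ℕ) (2 * L + 1 - j) + 1, ⟨by simp, by simp,
    fun j x a b => shoeCore L p j x a b, fun i => ?_⟩, fun j _ _ => le_rfl⟩
  let x : ℕ → ℕ := fun k => if h : k < 2 * L + 1 then (i ⟨k, h⟩ : ℕ) else 0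
  have hxi (k : Fin (2 * L + 1)) : (i k : ℕ) = x k := by simp only [x, dif_pos k.2]
  have hx (k : ℕ) : x k ≤ 1 := by
    simp only [x]
    split_ifs <;> omega
  have hleft : ∑ k ∈ univ.filter (fun k : Fin (2 * L + 1) => (k : ℕ) < L), x k =
      ∑ k ∈ range L, x k := by
    rw [sum_filter, Fin.sum_univ_eq_sum_range (fun k => if k < L then x k else 0), ← sum_filter]
    congr 1
    ext k
    simp
    omega
  have hright : ∑ k ∈ univ.filter (fun k : Fin (2 * L + 1) => L ≤ (k : ℕ)), x k =
      ∑ k ∈ Ico L (2 * L + 1), x k := by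
    rw [sum_filter, Fin.sum_univ_eq_sum_range (fun k => if L ≤ k then x k else 0), ← sum_filter]
    congr 1
    ext k
    simp
    omega
  simp only [hxi]
  rw [hleft, hright, Fin.sum_univ_eq_sum_range x, ← shoeCore_middle,
    sum_eq_single fun j : Fin (2 * L + 1 + 1) =>
      (⟨shoePath L x j, Nat.lt_succ_of_le (shoePath_le hx j)⟩ :
        Fin (min (j : ℕ) (2 * L + 1 - j) + 1))]
  · rw [prod_eq_single (⟨L, by omega⟩ : Fin (2 * L + 1))]
    · rfl
    · intro j _ hj
      exact shoeCore_shoePath p x j.2 fun h => hj (Fin.ext h)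
    · simp
  · intro α _ hα
    by_contra hne
    rw [← ne_eq, prod_ne_zero_iff] at hne
    refine hα (funext fun j => Fin.ext ?_)
    let a : ℕ → ℕ := fun k => if h : k < 2 * L + 1 + 1 then (α ⟨k, h⟩ : ℕ) else 0
    have ha (k : Fin (2 * L + 1 + 1)) : (α k : ℕ) = a k := by simp only [a, dif_pos k.2]
    have hbound (k : Fin (2 * L + 1 + 1)) : a k ≤ min (k : ℕ) (2 * L + 1 - k) := by
      rw [← ha]
      exact Nat.le_of_lt_succ (α k).2
    rw [ha]
    refine eq_shoePath_of_shoeCore_ne_zero (p := p) ?_ ?_ (fun k hk => ?_)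
      (Nat.le_of_lt_succ j.2)
    · simpa using hbound 0
    · simpa using hbound (Fin.last _)
    · have := hne ⟨k, hk⟩ (mem_univ _)
      rwa [ha, ha] at this
  · simp
end

section
/- Let d ≥ 2 and let c_1 ≥ c_2 ≥ ⋯ ≥ c_d ≥ 0 be real numbers sorted in descending order. Consider the airport-game tensor T : {0,1}^d → ℝ defined by T(i_1,…,i_d) = max{ c_k : i_k = 1 }, with the convention that the maximum over the empty set is 0 (i.e. T = 0 when all i_k = 0). Then T admits a TT-decomposition with all intermediate ranks r_j = 2 for 1 ≤ j ≤ d − 1; equivalently, T(i_1,…,i_d) = Σ_{k=1}^{d} c_k · [i_k = 1] · ∏_{j<k} [i_j = 0]. -/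
/-- Evaluating a sum over paths by backward recursion: if `V` satisfies the recursion given by
the transition weights `G` and equals `1` at the end, the weighted path sum is `∑ a, u a * V 0 a`. -/
theorem sum_path_eq_of_recursion {R : Type*} [CommSemiring R] {d : ℕ} (r : Fin (d + 1) → ℕ)
    (G : ∀ j : Fin d, Matrix (Fin (r j.castSucc)) (Fin (r j.succ)) R)
    (V : ∀ j : Fin (d + 1), Fin (r j) → R) (hlast : ∀ a, V (Fin.last d) a = 1)
    (hV : ∀ (j : Fin d) a, V j.castSucc a = ∑ b, G j a b * V j.succ b)
    (u : Fin (r 0) → R) :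
    ∑ α : ∀ j : Fin (d + 1), Fin (r j),
      u (α 0) * ∏ j : Fin d, G j (α j.castSucc) (α j.succ) = ∑ a, u a * V 0 a := by
  induction d with
  | zero =>
    rw [← (Fin.consEquiv fun j : Fin 1 => Fin (r j)).sum_comp, Fintype.sum_prod_type]
    refine Finset.sum_congr rfl fun a _ => ?_
    have h0 : V 0 a = 1 := hlast a
    simp [h0, Fin.consEquiv]
  | succ d ih =>
    rw [← (Fin.consEquiv fun j : Fin (d + 2) => Fin (r j)).sum_comp, Fintype.sum_prod_type]
    refine Finset.sum_congr rfl fun a _ => ?_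
    have h := ih (fun j => r j.succ) (fun j => G j.succ) (fun j => V j.succ) hlast
      (fun j => hV j.succ) (fun b => u a * G 0 a b)
    have h0 : V 0 a = ∑ b, G 0 a b * V 1 b := hV 0 a
    rw [h0, Finset.mul_sum]
    simp only [mul_assoc] at h
    refine Eq.trans (Finset.sum_congr rfl fun β _ => ?_) h
    rw [Fin.prod_univ_succ]
    rfl

/-- The maximum of an antitone nonnegative function over a finite set is attained at the least
element. -/
theorem fold_max_eq_of_isLeast {ι : Type*} [Preorder ι] {c : ι → ℝ} (hc : Antitone c)
    (hnonneg : ∀ k, 0 ≤ c k) {s : Finset ι} {m : ι} (hm : IsLeast (s : Set ι) m) :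
    s.fold max 0 c = c m := by
  refine le_antisymm ?_ ?_
  · exact (Finset.fold_max_le _).2 ⟨hnonneg m, fun k hk => hc (hm.2 hk)⟩
  · exact (Finset.le_fold_max _).2 (Or.inr ⟨m, hm.1, le_rfl⟩)

/-- The sum `∑ k, c k * [i k = 1] * ∏ j < k, [i j = 0]` picks out the first `k` with `i k = 1`. -/
theorem sum_first_one_eq_of_isLeast {d : ℕ} (c : Fin d → ℝ) (i : Fin d → Fin 2) {m : Fin d}
    (hm : IsLeast {k | i k = 1} m) :
    ∑ k : Fin d, c k * (if i k = 1 then 1 else 0) *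
      ∏ j ∈ Finset.univ.filter fun j : Fin d => j < k, (if i j = 0 then 1 else 0) = c m := by
  rw [Finset.sum_eq_single m]
  · rw [Finset.prod_eq_one, if_pos (show i m = 1 from hm.1)]
    · ring
    · intro j hj
      have hjm : j < m := by simpa using hj
      have hne : i j ≠ 1 := fun h => (hm.2 h).not_gt hjm
      exact if_pos (by omega)
  · intro k _ hkm
    by_cases hk : i k = 1
    · rw [Finset.prod_eq_zero (i := m)]
      · simp
      · simpa using lt_of_le_of_ne (hm.2 hk) hkm.symm
      · have h1 : i m = 1 := hm.1
        simp [h1]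
    · simp [hk]
  · simp

theorem fold_max_eq_sum_first_one {d : ℕ} {c : Fin d → ℝ} (hc : Antitone c)
    (hnonneg : ∀ k, 0 ≤ c k) (i : Fin d → Fin 2) :
    (Finset.univ.filter fun k : Fin d => i k = 1).fold max 0 c =
      ∑ k : Fin d, c k * (if i k = 1 then 1 else 0) *
        ∏ j ∈ Finset.univ.filter fun j : Fin d => j < k, (if i j = 0 then 1 else 0) := by
  rcases (Finset.univ.filter fun k : Fin d => i k = 1).eq_empty_or_nonempty with h | h
  · have hi : ∀ k, i k ≠ 1 := by simpa [Finset.filter_eq_empty_iff] using h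
    simp [hi]
  · have hm := Finset.isLeast_min' _ h
    rw [fold_max_eq_of_isLeast hc hnonneg hm, sum_first_one_eq_of_isLeast c i]
    simpa using hm

/-- The maximum of `c k` over the positions `k ≥ j` with `i k = 1`. -/
def tailMax {d : ℕ} (c : Fin d → ℝ) (i : Fin d → Fin 2) (j : Fin (d + 1)) : ℝ :=
  (Finset.univ.filter fun k : Fin d => i k = 1 ∧ j ≤ k.castSucc).fold max 0 c

theorem tailMax_zero {d : ℕ} (c : Fin d → ℝ) (i : Fin d → Fin 2) :
    tailMax c i 0 = (Finset.univ.filter fun k : Fin d => i k = 1).fold max 0 c := by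
  simp [tailMax]

theorem tailMax_last {d : ℕ} (c : Fin d → ℝ) (i : Fin d → Fin 2) :
    tailMax c i (Fin.last d) = 0 := by
  simp [tailMax]

theorem tailMax_castSucc {d : ℕ} {c : Fin d → ℝ} (hc : Antitone c) (hnonneg : ∀ k, 0 ≤ c k)
    (i : Fin d → Fin 2) (j : Fin d) :
    tailMax c i j.castSucc = if i j = 1 then c j else tailMax c i j.succ := by
  split_ifs with h
  · refine fold_max_eq_of_isLeast hc hnonneg ⟨by simp [h], fun k hk => ?_⟩
    simp only [Finset.coe_filter, Finset.mem_univ, true_and, Set.mem_ofPred_eq] at hk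
    exact hk.2
  · unfold tailMax
    congr 1
    ext k
    simp only [Finset.mem_filter, Finset.mem_univ, true_and, and_congr_right_iff]
    intro hk
    have hkj : k ≠ j := fun e => h (e ▸ hk)
    simp only [Fin.le_def, Fin.val_castSucc, Fin.val_succ]
    omega

/-- Ranks `1, 2, …, 2, 1`. -/
def airportRank (d : ℕ) (j : Fin (d + 1)) : ℕ :=
  if j = 0 ∨ j = Fin.last d then 1 else 2

/-- Core entries for the airport tensor. State `0` means that no index equal to `1` has been met;
any other state means that the value has already been collected. -/
noncomputable def airportCore {d : ℕ} (c : Fin d → ℝ) (j : Fin d) (x : Fin 2) (a b : ℕ) : ℂ :=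
  if j.succ = Fin.last d then
    if a = 0 then if x = 1 then c j else 0 else 1
  else if a = 0 then
    if b = 0 then if x = 1 then 0 else 1 else if x = 1 then c j else 0
  else if b = 0 then 0 else 1

/-- The contribution of the modes from `j` onwards when entering them in state `a`. -/
noncomputable def airportValue {d : ℕ} (c : Fin d → ℝ) (i : Fin d → Fin 2) (j : Fin (d + 1))
    (a : ℕ) : ℂ :=
  if j = Fin.last d then 1 else if a = 0 then tailMax c i j else 1

theorem airportValue_castSucc {d : ℕ} {c : Fin d → ℝ} (hc : Antitone c) (hnonneg : ∀ k, 0 ≤ c k)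
    (i : Fin d → Fin 2) (j : Fin d) (a : ℕ) :
    airportValue c i j.castSucc a =
      ∑ b : Fin (airportRank d j.succ), airportCore c j (i j) a b * airportValue c i j.succ b := by
  rw [Fin.sum_univ_eq_sum_range (fun b => airportCore c j (i j) a b * airportValue c i j.succ b)]
  have hj : j.castSucc ≠ Fin.last d := j.castSucc_lt_last.ne
  simp only [airportValue, if_neg hj, tailMax_castSucc hc hnonneg]
  by_cases hl : j.succ = Fin.last d
  · rw [show airportRank d j.succ = 1 from if_pos (Or.inr hl)]
    simp only [hl, tailMax_last, airportCore]
    split_ifs <;> simp_all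
  · rw [show airportRank d j.succ = 2 from if_neg (by simp [hl])]
    simp only [Finset.sum_range_succ, Finset.sum_range_zero, hl, airportCore]
    split_ifs <;> simp_all

theorem isTTDecomp_airport {d : ℕ} (hd : d ≠ 0) {c : Fin d → ℝ} (hc : Antitone c)
    (hnonneg : ∀ k, 0 ≤ c k) :
    IsTTDecomp (fun _ => 2) (airportRank d) fun i =>
      (((Finset.univ.filter fun k : Fin d => i k = 1).fold max 0 c : ℝ) : ℂ) := by
  refine ⟨if_pos (Or.inl rfl), if_pos (Or.inr rfl), fun j x a b => airportCore c j x a b,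
    fun i => ?_⟩
  have h := sum_path_eq_of_recursion (airportRank d)
    (fun j a b => airportCore c j (i j) a b) (fun j a => airportValue c i j a)
    (fun a => if_pos rfl) (fun j a => airportValue_castSucc hc hnonneg i j a) (fun _ => 1)
  simp only [one_mul] at h
  rw [h, Fin.sum_univ_eq_sum_range (fun a => airportValue c i 0 a),
    show airportRank d 0 = 1 from if_pos (Or.inl rfl)]
  have h0 : (0 : Fin (d + 1)) ≠ Fin.last d := by
    simpa [Fin.ext_iff] using hd.symm
  simp [airportValue, h0, tailMax_zero]

/-- the airport-game tensor `T(i) = max{c_k : i_k = 1}` (maximum over the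
empty set being 0), for `c` sorted in descending order and nonnegative, admits a
TT-decomposition with all intermediate ranks 2, and equals
`Σ_k c_k·[i_k = 1]·Π_{j<k}[i_j = 0]`. -/
theorem stmt14 (d : ℕ) (hd : 2 ≤ d) (c : Fin d → ℝ)
    (hsort : ∀ j k : Fin d, j ≤ k → c k ≤ c j) (hnonneg : ∀ k, 0 ≤ c k)
    (T : (∀ _ : Fin d, Fin 2) → ℝ)
    (hT : ∀ i, T i = (Finset.univ.filter fun k : Fin d => i k = 1).fold max 0 c) :
    (∀ i, T i = ∑ k : Fin d, c k * (if i k = 1 then 1 else 0) *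
        ∏ j ∈ Finset.univ.filter fun j : Fin d => j < k, (if i j = 0 then 1 else 0)) ∧
    ∃ r : Fin (d + 1) → ℕ,
      IsTTDecomp (fun _ => 2) r (fun i => (T i : ℂ)) ∧
      ∀ j : Fin (d + 1), 1 ≤ (j : ℕ) → (j : ℕ) ≤ d - 1 → r j = 2 := by
  have hc : Antitone c := fun j k h => hsort j k h
  refine ⟨fun i => (hT i).trans (fold_max_eq_sum_first_one hc hnonneg i), airportRank d, ?_, ?_⟩
  · simpa only [hT] using isTTDecomp_airport (by omega) hc hnonneg
  · intro j h1 h2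
    refine if_neg ?_
    simp only [Fin.ext_iff, Fin.val_zero, Fin.val_last]
    omega
end
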